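/- arXiv:1510.03670 — 4 statements merged into one kernel-verified Lean document; each statement's English description precedes it below -/
import Mathlib

section
/- Let m be a nonnegative integer and let D = Supp(c) for some nonzero codeword c ∈ C_m. Then at least one of the following two conditions holds: (i) x^{q+1} ∈ In_≺(I_D) and x^{q} ∉ In_≺(I_D); (ii) y^{q} ∈ In_≺(I_D). -/
open MvPolynomial

noncomputable section

/-- The monomial `x^r y^s` in `F[x,y]`, where `x = X 0`, `y = X 1`. -/
def monoXY (F : Type) [Field F] (r s : ℕ) : MvPolynomial (Fin 2) F := X 0 ^ r * X 1 ^ s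

/-- The Hermitian polynomial `H = x^(q+1) - y^q - y`. -/
def Hpoly (F : Type) [Field F] (q : ℕ) : MvPolynomial (Fin 2) F :=
  X 0 ^ (q + 1) - X 1 ^ q - X 1

/-- Evaluation of a bivariate polynomial at a point of `F × F`. -/
def evalPt {F : Type} [Field F] (p : F × F) (f : MvPolynomial (Fin 2) F) : F :=
  MvPolynomial.eval ![p.1, p.2] f

/-- The vanishing ideal of a set of points `S ⊆ F × F`. -/
def vanIdeal (F : Type) [Field F] (S : Set (F × F)) : Ideal (MvPolynomial (Fin 2) F) where
  carrier := {f | ∀ p ∈ S, evalPt p f = 0}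
  add_mem' := by
    intro a b ha hb p hp
    have h1 := ha p hp
    have h2 := hb p hp
    simp only [evalPt] at h1 h2 ⊢
    simp [map_add, h1, h2]
  zero_mem' := by
    intro p hp
    simp [evalPt]
  smul_mem' := by
    intro c f hf p hp
    have h1 := hf p hp
    simp only [evalPt] at h1 ⊢
    simp [smul_eq_mul, map_mul, h1]

/-- The `DegRevLex` order with `y > x`, on exponent pairs `(a, b) ↔ x^a y^b`. -/
def precOrd : ℕ × ℕ → ℕ × ℕ → Prop := fun a b =>
  a.1 + a.2 < b.1 + b.2 ∨ (a.1 + a.2 = b.1 + b.2 ∧ a.2 < b.2)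

/-- The pair of exponents `(d 0, d 1)` of an exponent finsupp. -/
def expPair (d : Fin 2 →₀ ℕ) : ℕ × ℕ := (d 0, d 1)

/-- `x^r y^s` is the leading monomial of `f` with respect to the monomial order `lt`. -/
def IsLMwith {F : Type} [Field F] (lt : ℕ × ℕ → ℕ × ℕ → Prop)
    (f : MvPolynomial (Fin 2) F) (r s : ℕ) : Prop :=
  MvPolynomial.coeff (Finsupp.single 0 r + Finsupp.single 1 s) f ≠ 0 ∧
    ∀ d ∈ f.support, expPair d = (r, s) ∨ lt (expPair d) (r, s)

/-- The initial ideal of `I` w.r.t. the monomial order `lt`: the ideal generated by the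
leading monomials of the nonzero elements of `I`. -/
def initialIdealWith {F : Type} [Field F] (lt : ℕ × ℕ → ℕ × ℕ → Prop)
    (I : Ideal (MvPolynomial (Fin 2) F)) : Ideal (MvPolynomial (Fin 2) F) :=
  Ideal.span {g | ∃ f ∈ I, f ≠ 0 ∧ ∃ r s, IsLMwith lt f r s ∧ g = monoXY F r s}

/-- The set `E` of `F`-rational affine points of the Hermitian curve. -/
def Eset (F : Type) [Field F] (q : ℕ) : Set (F × F) :=
  {p | p.1 ^ (q + 1) = p.2 ^ q + p.2}

/-- The set `B` of (exponent pairs of) monomials. -/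
def Bset (q : ℕ) : Set (ℕ × ℕ) :=
  {p | (p.1 ≤ q ∧ p.2 ≤ q ^ 2 - q - 1) ∨ (p.1 = 0 ∧ q ^ 2 - q ≤ p.2 ∧ p.2 ≤ q ^ 2 - 1)}

/-- The Hermitian code `C_m` (as a set of vectors), for the enumeration `P` of `E`. -/
def codeSet (F : Type) [Field F] (q m : ℕ) (P : Fin (q ^ 3) → F × F) :
    Set (Fin (q ^ 3) → F) :=
  {c | ∀ r s : ℕ, r * q + s * (q + 1) ≤ m → ∑ i, c i * ((P i).1 ^ r * (P i).2 ^ s) = 0}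

/-- The weight of a codeword: the number of nonzero entries. -/
def wt {F : Type} [Field F] {n : ℕ} (c : Fin n → F) : ℕ := {i | c i ≠ 0}.ncard

/-- The support of a codeword, as a set of points of the curve. -/
def suppPts {F : Type} [Field F] {n : ℕ} (P : Fin n → F × F) (c : Fin n → F) :
    Set (F × F) :=
  P '' {i | c i ≠ 0}

end

theorem monoXY_eq_monomial (F : Type) [Field F] (r s : ℕ) :
    monoXY F r s = monomial (Finsupp.single 0 r + Finsupp.single 1 s) 1 := by
  rw [monoXY, X_pow_eq_monomial, X_pow_eq_monomial, monomial_mul, one_mul]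

theorem finsupp_fin_two_eq_iff (d : Fin 2 →₀ ℕ) (r s : ℕ) :
    Finsupp.single 0 r + Finsupp.single 1 s = d ↔ d 0 = r ∧ d 1 = s := by
  constructor
  · rintro rfl
    simp
  · rintro ⟨rfl, rfl⟩
    ext i
    fin_cases i <;> simp

theorem coeff_monoXY (F : Type) [Field F] (r s : ℕ) (d : Fin 2 →₀ ℕ) :
    coeff d (monoXY F r s) = if d 0 = r ∧ d 1 = s then 1 else 0 := by
  simp only [monoXY_eq_monomial, coeff_monomial, finsupp_fin_two_eq_iff]

theorem Hpoly_eq_monoXY (F : Type) [Field F] (q : ℕ) :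
    Hpoly F q = monoXY F (q + 1) 0 - monoXY F 0 q - monoXY F 0 1 := by
  simp [Hpoly, monoXY]

theorem Hpoly_mem_vanIdeal {F : Type} [Field F] {q : ℕ} {S : Set (F × F)}
    (hS : S ⊆ Eset F q) : Hpoly F q ∈ vanIdeal F S := by
  intro p hp
  have h : p.1 ^ (q + 1) = p.2 ^ q + p.2 := hS hp
  simp [evalPt, Hpoly, h]

theorem monoXY_mem_initialIdealWith {F : Type} [Field F] {lt : ℕ × ℕ → ℕ × ℕ → Prop}
    {I : Ideal (MvPolynomial (Fin 2) F)} {f : MvPolynomial (Fin 2) F} {r s : ℕ}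
    (hf : f ∈ I) (h : IsLMwith lt f r s) : monoXY F r s ∈ initialIdealWith lt I := by
  refine Ideal.subset_span ⟨f, hf, ?_, r, s, h, rfl⟩
  rintro rfl
  exact h.1 (coeff_zero _)

theorem exists_isLMwith_of_monoXY_mem {F : Type} [Field F] {lt : ℕ × ℕ → ℕ × ℕ → Prop}
    {I : Ideal (MvPolynomial (Fin 2) F)} {a b : ℕ}
    (h : monoXY F a b ∈ initialIdealWith lt I) :
    ∃ f ∈ I, ∃ r s, r ≤ a ∧ s ≤ b ∧ IsLMwith lt f r s := by
  have hset : {g | ∃ f ∈ I, f ≠ 0 ∧ ∃ r s, IsLMwith lt f r s ∧ g = monoXY F r s} =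
      (fun e => monomial e (1 : F)) '' {e : Fin 2 →₀ ℕ | ∃ f ∈ I, f ≠ 0 ∧
        ∃ r s, IsLMwith lt f r s ∧ e = Finsupp.single 0 r + Finsupp.single 1 s} := by
    ext g
    constructor
    · rintro ⟨f, hf, hf0, r, s, hlm, rfl⟩
      exact ⟨_, ⟨f, hf, hf0, r, s, hlm, rfl⟩, (monoXY_eq_monomial F r s).symm⟩
    · rintro ⟨_, ⟨f, hf, hf0, r, s, hlm, rfl⟩, rfl⟩
      exact ⟨f, hf, hf0, r, s, hlm, (monoXY_eq_monomial F r s).symm⟩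
  rw [initialIdealWith, hset, mem_ideal_span_monomial_image] at h
  obtain ⟨_, ⟨f, hf, -, r, s, hlm, rfl⟩, hle⟩ :=
    h (Finsupp.single 0 a + Finsupp.single 1 b) (by simp [mem_support_iff, coeff_monoXY])
  exact ⟨f, hf, r, s, by simpa using hle 0, by simpa using hle 1, hlm⟩

theorem isLMwith_Hpoly {F : Type} [Field F] {q : ℕ} (hq : 1 ≤ q) :
    IsLMwith precOrd (Hpoly F q) (q + 1) 0 := by
  constructor
  · simp [Hpoly_eq_monoXY, coeff_monoXY]
  · intro d hd
    simp only [Hpoly_eq_monoXY, mem_support_iff, coeff_sub, coeff_monoXY] at hd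
    simp only [expPair, precOrd, Prod.mk.injEq]
    by_contra hcon
    refine hd ?_
    rw [if_neg (by omega), if_neg (by omega), if_neg (by omega)]
    simp

/-- If `f` has leading monomial `x^r` with `r ≤ q`, then eliminating `x^(q+1)` between a multiple
of `f` and the Hermitian polynomial gives a polynomial with leading monomial `y^q`. -/
theorem isLMwith_sub_Hpoly {F : Type} [Field F] {q r : ℕ} (hq : 2 ≤ q) (hr : r ≤ q)
    {f : MvPolynomial (Fin 2) F} (hf : IsLMwith precOrd f r 0) :
    IsLMwith precOrd (monoXY F (q + 1 - r) 0 * f -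
      C (coeff (Finsupp.single 0 r + Finsupp.single 1 0) f) * Hpoly F q) 0 q := by
  obtain ⟨hlc, hlt⟩ := hf
  constructor
  · rw [coeff_sub, monoXY_eq_monomial, coeff_monomial_mul', if_neg, coeff_C_mul,
      Hpoly_eq_monoXY]
    · simpa [coeff_monoXY, show q ≠ 1 by omega] using hlc
    · intro h
      have := h 0
      simp at this
      omega
  · intro d hd
    simp only [expPair, precOrd, Prod.mk.injEq]
    by_contra hcon
    refine mem_support_iff.1 hd ?_
    rw [coeff_sub, coeff_C_mul, Hpoly_eq_monoXY, coeff_sub, coeff_sub, coeff_monoXY,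
      coeff_monoXY, coeff_monoXY, monoXY_eq_monomial, coeff_monomial_mul', one_mul,
      if_neg (show ¬(d 0 = 0 ∧ d 1 = q) by omega), if_neg (show ¬(d 0 = 0 ∧ d 1 = 1) by omega)]
    by_cases hd' : d 0 = q + 1 ∧ d 1 = 0
    · have hsub : d - (Finsupp.single 0 (q + 1 - r) + Finsupp.single 1 0) =
          Finsupp.single 0 r + Finsupp.single 1 0 := by
        symm
        rw [finsupp_fin_two_eq_iff]
        simp
        omega
      rw [if_pos, if_pos hd', hsub]
      · simp
      · intro i
        fin_cases i <;> simp
        omega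
    · rw [if_neg hd', sub_zero, sub_zero, mul_zero, sub_zero]
      split_ifs with hle
      · by_contra hne
        have h0 := hle 0
        have h := hlt _ (mem_support_iff.2 hne)
        simp [expPair, precOrd] at h h0
        omega
      · rfl

theorem stmt_12 (q : ℕ) (hq2 : 2 ≤ q) (hq : IsPrimePow q)
    (F : Type) [Field F] [Fintype F] (hF : Fintype.card F = q ^ 2)
    (P : Fin (q ^ 3) → F × F) (hPinj : Function.Injective P)
    (hPrange : Set.range P = Eset F q)
    (m : ℕ) (c : Fin (q ^ 3) → F) (hc : c ∈ codeSet F q m P) (hc0 : c ≠ 0) :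
    (monoXY F (q + 1) 0 ∈ initialIdealWith precOrd (vanIdeal F (suppPts P c)) ∧
        monoXY F q 0 ∉ initialIdealWith precOrd (vanIdeal F (suppPts P c))) ∨
      monoXY F 0 q ∈ initialIdealWith precOrd (vanIdeal F (suppPts P c)) := by
  have hS : suppPts P c ⊆ Eset F q := by
    rw [← hPrange]
    exact Set.image_subset_range _ _
  have hH := Hpoly_mem_vanIdeal hS
  by_cases hx : monoXY F q 0 ∈ initialIdealWith precOrd (vanIdeal F (suppPts P c))
  · right
    obtain ⟨f, hf, r, s, hr, hs, hlm⟩ := exists_isLMwith_of_monoXY_mem hx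
    obtain rfl : s = 0 := Nat.le_zero.1 hs
    exact monoXY_mem_initialIdealWith
      (Ideal.sub_mem _ (Ideal.mul_mem_left _ _ hf) (Ideal.mul_mem_left _ _ hH))
      (isLMwith_sub_Hpoly hq2 hr hlm)
  · exact Or.inl ⟨monoXY_mem_initialIdealWith hH (isLMwith_Hpoly (by omega)), hx⟩
end

section
/- Let m ≥ 2q^2 - 2q - 2 and let D = Supp(c) for some nonzero codeword c ∈ C_m. Then x^{q} ∉ In_≺(I_D) or y^{q-1} ∉ In_≺(I_D). -/
open MvPolynomial

theorem wellFounded_precOrd : WellFounded precOrd := by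
  refine Subrelation.wf ?_ (InvImage.wf (fun p : ℕ × ℕ => (p.1 + p.2, p.2))
    (WellFounded.prod_lex Nat.lt_wfRel.wf Nat.lt_wfRel.wf))
  intro a b h
  simp only [InvImage, Prod.lex_def]
  exact h

theorem single_add_single_eq (d : Fin 2 →₀ ℕ) :
    Finsupp.single 0 (d 0) + Finsupp.single 1 (d 1) = d := by
  ext i
  fin_cases i <;> simp

/-- A monomial of the initial ideal of `I` is itself a leading monomial of an element of `I`. -/
theorem exists_leading_of_mem_initialIdealWith {F : Type} [Field F]
    {I : Ideal (MvPolynomial (Fin 2) F)} {d : Fin 2 →₀ ℕ}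
    (h : monomial d (1 : F) ∈ initialIdealWith precOrd I) :
    ∃ f ∈ I, coeff d f ≠ 0 ∧ ∀ e ∈ f.support, e = d ∨ precOrd (expPair e) (expPair d) := by
  have hspan : initialIdealWith precOrd I = Ideal.span ((fun e => monomial e (1 : F)) ''
      {e | ∃ f ∈ I, f ≠ 0 ∧ IsLMwith precOrd f (e 0) (e 1)}) := by
    unfold initialIdealWith
    congr 1
    ext g
    constructor
    · rintro ⟨f, hf, hf0, r, s, hlm, rfl⟩
      exact ⟨Finsupp.single 0 r + Finsupp.single 1 s, ⟨f, hf, hf0, by simpa using hlm⟩,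
        (monoXY_eq_monomial F r s).symm⟩
    · rintro ⟨e, ⟨f, hf, hf0, hlm⟩, rfl⟩
      exact ⟨f, hf, hf0, e 0, e 1, hlm, by rw [monoXY_eq_monomial, single_add_single_eq]⟩
  rw [hspan, mem_ideal_span_monomial_image] at h
  obtain ⟨e, ⟨f, hf, -, hcoeff, hlt⟩, hed⟩ := h d (by simp [mem_support_iff])
  rw [single_add_single_eq] at hcoeff
  refine ⟨monomial (d - e) 1 * f, I.mul_mem_left _ hf, ?_, ?_⟩
  · rw [coeff_monomial_mul', if_pos tsub_le_self, tsub_tsub_cancel_of_le hed, one_mul]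
    exact hcoeff
  · intro k hk
    rw [mem_support_iff, coeff_monomial_mul'] at hk
    split_ifs at hk with hle
    · have hk' := hlt (k - (d - e)) (by simpa [mem_support_iff] using hk)
      have l0 := hle 0
      have l1 := hle 1
      have m0 := hed 0
      have m1 := hed 1
      simp only [expPair, precOrd, Finsupp.tsub_apply, Prod.mk.injEq] at hk' l0 l1 ⊢
      rcases hk' with hk' | hk'
      · left
        ext i
        fin_cases i
        · change k 0 = d 0
          omega
        · change k 1 = d 1
          omega
      · right
        omega
    · exact absurd rfl hk

/-- A linear functional vanishing on `I` and on the standard monomials of `I` is zero. -/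
theorem linearMap_eq_zero_of_standard_monomials {F : Type} [Field F]
    {I : Ideal (MvPolynomial (Fin 2) F)} (φ : MvPolynomial (Fin 2) F →ₗ[F] F)
    (hI : ∀ f ∈ I, φ f = 0)
    (hstd : ∀ d, monomial d (1 : F) ∉ initialIdealWith precOrd I → φ (monomial d 1) = 0) :
    φ = 0 := by
  have smul_mono (d : Fin 2 →₀ ℕ) (a : F) : φ (monomial d a) = a * φ (monomial d 1) := by
    rw [← smul_eq_mul, ← map_smul, smul_monomial, smul_eq_mul, mul_one]
  have key (d : Fin 2 →₀ ℕ) : φ (monomial d 1) = 0 := by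
    induction d using (InvImage.wf expPair wellFounded_precOrd).induction with
    | _ d ih =>
      by_cases hd : monomial d (1 : F) ∈ initialIdealWith precOrd I
      · obtain ⟨f, hf, hcoeff, hlt⟩ := exists_leading_of_mem_initialIdealWith hd
        have h := hI f hf
        rw [f.as_sum, map_sum, Finset.sum_eq_single d] at h
        · rw [smul_mono] at h
          exact (mul_eq_zero.mp h).resolve_left hcoeff
        · intro e he hne
          rw [smul_mono, ih e ((hlt e he).resolve_left hne), mul_zero]
        · intro hnot
          exact absurd (mem_support_iff.mpr hcoeff) hnot
      · exact hstd d hd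
  refine LinearMap.ext fun f => ?_
  rw [f.as_sum, map_sum, LinearMap.zero_apply]
  exact Finset.sum_eq_zero fun d _ => by rw [smul_mono, key, mul_zero]

theorem monomial_mem_of_le {F : Type} [Field F] {J : Ideal (MvPolynomial (Fin 2) F)}
    {e d : Fin 2 →₀ ℕ} (h : monomial e (1 : F) ∈ J) (hle : e ≤ d) : monomial d (1 : F) ∈ J :=
  J.mem_of_dvd (monomial_dvd_monomial.mpr ⟨Or.inr hle, one_dvd _⟩) h

theorem stmt_13 (q : ℕ) (hq2 : 2 ≤ q) (hq : IsPrimePow q)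
    (F : Type) [Field F] [Fintype F] (hF : Fintype.card F = q ^ 2)
    (P : Fin (q ^ 3) → F × F) (hPinj : Function.Injective P)
    (hPrange : Set.range P = Eset F q)
    (m : ℕ) (hm : 2 * q ^ 2 - 2 * q - 2 ≤ m)
    (c : Fin (q ^ 3) → F) (hc : c ∈ codeSet F q m P) (hc0 : c ≠ 0) :
    monoXY F q 0 ∉ initialIdealWith precOrd (vanIdeal F (suppPts P c)) ∨
      monoXY F 0 (q - 1) ∉ initialIdealWith precOrd (vanIdeal F (suppPts P c)) := by
  classical
  by_contra! hcon
  obtain ⟨hx, hy⟩ := hcon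
  rw [monoXY_eq_monomial] at hx hy
  let φ : MvPolynomial (Fin 2) F →ₗ[F] F :=
    ∑ i, c i • (aeval (R := F) ![(P i).1, (P i).2]).toLinearMap
  have hφ (f : MvPolynomial (Fin 2) F) : φ f = ∑ i, c i * evalPt (P i) f := by
    simp [φ, evalPt, aeval_eq_eval]
  have hzero : φ = 0 := by
    refine linearMap_eq_zero_of_standard_monomials (I := vanIdeal F (suppPts P c)) φ ?_ ?_
    · intro f hf
      rw [hφ]
      refine Finset.sum_eq_zero fun i _ => ?_
      by_cases hi : c i = 0
      · rw [hi, zero_mul]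
      · rw [hf (P i) ⟨i, hi, rfl⟩, mul_zero]
    · intro d hd
      have h0 : d 0 < q := by
        by_contra! h
        refine hd (monomial_mem_of_le hx fun i => ?_)
        fin_cases i <;> simp [h]
      have h1 : d 1 < q - 1 := by
        by_contra! h
        refine hd (monomial_mem_of_le hy fun i => ?_)
        fin_cases i
        · simp
        · simpa using h
      have hle : d 0 * q + d 1 * (q + 1) ≤ m := by
        refine le_trans ?_ hm
        obtain ⟨k, rfl⟩ := Nat.exists_eq_add_of_le' hq2
        have a0 : d 0 * (k + 2) ≤ (k + 1) * (k + 2) := Nat.mul_le_mul_right _ (by omega)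
        have a1 : d 1 * (k + 2 + 1) ≤ k * (k + 2 + 1) := Nat.mul_le_mul_right _ (by omega)
        have e : 2 * (k + 2) ^ 2 = (k + 1) * (k + 2) + k * (k + 2 + 1) + 2 * (k + 2) + 2 := by
          ring
        omega
      rw [hφ, ← hc _ _ hle]
      refine Finset.sum_congr rfl fun i _ => ?_
      simp [evalPt, eval_monomial, Finsupp.prod_fintype]
  refine hc0 (funext fun i => ?_)
  have h := hφ (indicator ![(P i).1, (P i).2])
  rw [hzero, LinearMap.zero_apply, Finset.sum_eq_single i] at h
  · simpa [evalPt, eval_indicator_apply_eq_one] using h.symm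
  · intro j _ hj
    rw [evalPt, eval_indicator_apply_eq_zero, mul_zero]
    intro heq
    refine hj (hPinj (Prod.ext ?_ ?_))
    · simpa using congrFun heq 0
    · simpa using congrFun heq 1
  · simp
end

section
/- Let m ≥ 2q^2 - 2q - 2 and let x^a y^b ∈ B be a monomial with m+1 ≤ aq + b(q+1) ≤ m+q+1. Then there exists a subset D' ⊆ E such that x^a y^b belongs to the sous-escalier N(In_≺(I_{D'})), |D'| = aq + b(q+1) - (q^2 - q) + 1, and there exists a nonzero codeword of C_m whose support is contained in D'. -/
open MvPolynomial

/-- The rational affine points of the Hermitian curve, as a finset. -/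
noncomputable def hermitianPoints (F : Type) [Field F] [Fintype F] (q : ℕ) : Finset (F × F) := by
  classical exact Finset.univ.filter fun p => p.1 ^ (q + 1) = p.2 ^ q + p.2

section HermitianCurve

open Finset

open scoped Classical

variable {F : Type} [Field F] [Fintype F] {q : ℕ}

theorem mem_hermitianPoints {p : F × F} :
    p ∈ hermitianPoints F q ↔ p.1 ^ (q + 1) = p.2 ^ q + p.2 := by
  simp [hermitianPoints]

theorem sum_hermitianPoints_eq_sum_fst {M : Type*} [AddCommMonoid M] (f : F × F → M) :
    ∑ p ∈ hermitianPoints F q, f p =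
      ∑ x : F, ∑ y ∈ univ.filter (fun y : F => x ^ (q + 1) = y ^ q + y), f (x, y) := by
  simp only [hermitianPoints, sum_filter]
  rw [← univ_product_univ, sum_product]

theorem sum_hermitianPoints_eq_sum_snd {M : Type*} [AddCommMonoid M] (f : F × F → M) :
    ∑ p ∈ hermitianPoints F q, f p =
      ∑ y : F, ∑ x ∈ univ.filter (fun x : F => x ^ (q + 1) = y ^ q + y), f (x, y) := by
  simp only [hermitianPoints, sum_filter]
  rw [← univ_product_univ, sum_product_right]

theorem card_trace_fiber_le (hq2 : 2 ≤ q) (c : F) :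
    (univ.filter fun y : F => c = y ^ q + y).card ≤ q := by
  let p : Polynomial F := Polynomial.X ^ q + (Polynomial.X - Polynomial.C c)
  have hdeg : (Polynomial.X - Polynomial.C c : Polynomial F).degree < (q : ℕ) := by
    rw [Polynomial.degree_X_sub_C]
    exact_mod_cast (by omega : 1 < q)
  have hm : p.Monic := Polynomial.monic_X_pow_add hdeg
  have hd : p.natDegree = q := by
    apply Polynomial.natDegree_eq_of_degree_eq_some
    rw [Polynomial.degree_add_eq_left_of_degree_lt (by rwa [Polynomial.degree_X_pow]),
      Polynomial.degree_X_pow]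
  calc _ ≤ p.roots.toFinset.card := by
        apply card_le_card
        intro y hy
        have hy' : c = y ^ q + y := by simpa using hy
        rw [Multiset.mem_toFinset, Polynomial.mem_roots hm.ne_zero]
        simp [p, hy']
    _ ≤ p.roots.card := Multiset.toFinset_card_le _
    _ ≤ q := hd ▸ p.card_roots'

theorem card_norm_fiber_le (t : F) :
    (univ.filter fun x : F => x ^ (q + 1) = t).card ≤ q + 1 := by
  calc _ ≤ (Polynomial.nthRoots (q + 1) t).toFinset.card := by
        apply card_le_card
        intro x hx
        simpa [Polynomial.mem_nthRoots] using hx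
    _ ≤ _ := Multiset.toFinset_card_le _
    _ ≤ q + 1 := Polynomial.card_nthRoots _ _

theorem card_trace_fiber (hq2 : 2 ≤ q) (hF : Fintype.card F = q ^ 2)
    (hE : (hermitianPoints F q).card = q ^ 3) (x : F) :
    (univ.filter fun y : F => x ^ (q + 1) = y ^ q + y).card = q := by
  have h := sum_hermitianPoints_eq_sum_fst (F := F) (q := q) fun _ => 1
  simp only [← card_eq_sum_ones, hE] at h
  have hsum : ∑ x : F, (univ.filter fun y : F => x ^ (q + 1) = y ^ q + y).card =
      ∑ _x : F, q := by
    rw [← h, sum_const, card_univ, hF, smul_eq_mul]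
    ring
  exact (sum_eq_sum_iff_of_le fun x _ => card_trace_fiber_le hq2 _).1 hsum x (mem_univ x)

theorem card_trace_eq_zero (hq2 : 2 ≤ q) (hF : Fintype.card F = q ^ 2)
    (hE : (hermitianPoints F q).card = q ^ 3) :
    (univ.filter fun y : F => y ^ q + y = 0).card = q := by
  simpa [eq_comm] using card_trace_fiber hq2 hF hE 0

theorem card_trace_ne_zero (hq2 : 2 ≤ q) (hF : Fintype.card F = q ^ 2)
    (hE : (hermitianPoints F q).card = q ^ 3) :
    (univ.filter fun y : F => y ^ q + y ≠ 0).card = q ^ 2 - q := by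
  have h := card_filter_add_card_filter_not (s := (univ : Finset F)) fun y : F => y ^ q + y = 0
  rw [card_trace_eq_zero hq2 hF hE, card_univ, hF] at h
  simp only [ne_eq]
  omega

theorem card_norm_fiber (hq2 : 2 ≤ q) (hF : Fintype.card F = q ^ 2)
    (hE : (hermitianPoints F q).card = q ^ 3) (y : F) :
    (univ.filter fun x : F => x ^ (q + 1) = y ^ q + y).card =
      if y ^ q + y = 0 then 1 else q + 1 := by
  have h := sum_hermitianPoints_eq_sum_snd (F := F) (q := q) fun _ => 1
  simp only [← card_eq_sum_ones, hE] at h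
  have hle : ∀ y ∈ (univ : Finset F),
      (univ.filter fun x : F => x ^ (q + 1) = y ^ q + y).card ≤
        if y ^ q + y = 0 then 1 else q + 1 := by
    intro y _
    split_ifs with h0
    · rw [card_le_one]
      simp [h0]
    · exact card_norm_fiber_le _
  have hsum : ∑ y : F, (univ.filter fun x : F => x ^ (q + 1) = y ^ q + y).card =
      ∑ y : F, if y ^ q + y = 0 then 1 else q + 1 := by
    rw [← h, sum_ite, sum_const, sum_const, card_trace_eq_zero hq2 hF hE,
      card_trace_ne_zero hq2 hF hE, smul_eq_mul, smul_eq_mul]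
    have : q ≤ q ^ 2 := by nlinarith
    zify [this]
    ring
  exact (sum_eq_sum_iff_of_le hle).1 hsum y (mem_univ y)

theorem cast_eq_zero_of_card_eq_sq (hF : Fintype.card F = q ^ 2) : (q : F) = 0 := by
  have h := FiniteField.cast_card_eq_zero F
  rw [hF] at h
  push_cast at h
  exact pow_eq_zero_iff (two_ne_zero) |>.1 h

theorem sum_pow_card_sub_one (hF : Fintype.card F = q ^ 2) (hq2 : 2 ≤ q) :
    ∑ y : F, y ^ (q ^ 2 - 1) = -1 := by
  have h4 : 2 ≤ q ^ 2 := by nlinarith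
  have h : ∀ y : F, y ^ (q ^ 2 - 1) = if y = 0 then 0 else 1 := by
    intro y
    split_ifs with h0
    · rw [h0, zero_pow (by omega)]
    · rw [← hF]
      exact FiniteField.pow_card_sub_one_eq_one y h0
  simp only [h]
  rw [show (fun y : F => if y = 0 then (0 : F) else 1) = fun y => 1 - if y = 0 then 1 else 0 by
    ext y; split_ifs <;> simp]
  rw [sum_sub_distrib]
  simp [hF, cast_eq_zero_of_card_eq_sq hF]

theorem sum_trace_pow_mul_pow (hF : Fintype.card F = q ^ 2) (hq2 : 2 ≤ q) (k : ℕ) :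
    ∀ s : ℕ, k * q + s ≤ q ^ 2 - 1 →
      ∑ y : F, (y ^ q + y) ^ k * y ^ s = ∑ y : F, y ^ (k * q + s) := by
  induction k with
  | zero => simp
  | succ k ih =>
    intro s hs
    have h1 : k * q + (s + q) ≤ q ^ 2 - 1 := by linarith
    have h2 : k * q + (s + 1) < q ^ 2 - 1 := by linarith
    have h3 : ∑ y : F, y ^ (k * q + (s + 1)) = 0 :=
      FiniteField.sum_pow_lt_card_sub_one F _ (by rwa [hF])
    calc _ = ∑ y : F, (y ^ q + y) ^ k * y ^ (s + q) + ∑ y : F, (y ^ q + y) ^ k * y ^ (s + 1) := by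
          rw [← sum_add_distrib]
          exact sum_congr rfl fun y _ => by ring
      _ = _ := by
          rw [ih _ h1, ih _ h2.le, h3, add_zero]
          exact sum_congr rfl fun y _ => by congr 1; ring

theorem exists_pow_eq_one_and_pow_ne_one (hF : Fintype.card F = q ^ 2) (hq2 : 2 ≤ q) {r : ℕ}
    (hr : ¬ (q + 1) ∣ r) : ∃ z : F, z ^ (q + 1) = 1 ∧ z ^ r ≠ 1 := by
  obtain ⟨g, hg⟩ := IsCyclic.exists_generator (α := Fˣ)
  have hord : orderOf g = (q - 1) * (q + 1) := by
    rw [orderOf_eq_card_of_forall_mem_zpowers hg, Nat.card_eq_fintype_card, Fintype.card_units, hF]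
    obtain ⟨k, rfl⟩ : ∃ k, q = k + 1 := ⟨q - 1, by omega⟩
    simp only [Nat.add_sub_cancel]
    rw [Nat.sub_eq_iff_eq_add (by nlinarith)]
    ring
  refine ⟨((g ^ (q - 1) : Fˣ) : F), ?_, ?_⟩
  · rw [← Units.val_pow_eq_pow_val, ← pow_mul, ← hord, pow_orderOf_eq_one, Units.val_one]
  · rw [← Units.val_pow_eq_pow_val, ← pow_mul, Ne, Units.val_eq_one, ← orderOf_dvd_iff_pow_eq_one,
      hord]
    exact fun h => hr (Nat.dvd_of_mul_dvd_mul_left (by omega) h)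

theorem sum_hermitianPoints_of_not_dvd (hF : Fintype.card F = q ^ 2) (hq2 : 2 ≤ q) {r : ℕ}
    (hr : ¬ (q + 1) ∣ r) (s : ℕ) : ∑ p ∈ hermitianPoints F q, p.1 ^ r * p.2 ^ s = 0 := by
  obtain ⟨z, hz, hzr⟩ := exists_pow_eq_one_and_pow_ne_one hF hq2 hr
  have hz0 : z ≠ 0 := by
    rintro rfl
    simp at hz
  have h : ∑ p ∈ hermitianPoints F q, p.1 ^ r * p.2 ^ s =
      ∑ p ∈ hermitianPoints F q, z ^ r * (p.1 ^ r * p.2 ^ s) := by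
    symm
    refine sum_bij (fun p _ => (z * p.1, p.2)) ?_ ?_ ?_ ?_
    · intro p hp
      rw [mem_hermitianPoints] at hp ⊢
      simp [mul_pow, hz, hp]
    · rintro ⟨x, y⟩ _ ⟨x', y'⟩ _ h
      simpa [hz0] using h
    · rintro ⟨x, y⟩ hp
      refine ⟨(z⁻¹ * x, y), ?_, by simp [hz0]⟩
      rw [mem_hermitianPoints] at hp ⊢
      simpa [mul_pow, hz] using hp
    · intro p _
      ring
  rw [← mul_sum] at h
  by_contra h0
  exact hzr (mul_right_cancel₀ h0 (by rw [one_mul]; exact h.symm))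

theorem sum_hermitianPoints_of_mul (hF : Fintype.card F = q ^ 2) (hq2 : 2 ≤ q)
    (hE : (hermitianPoints F q).card = q ^ 3) {k s : ℕ} (hks : k * q + s ≤ q ^ 2 - 1) :
    ∑ p ∈ hermitianPoints F q, p.1 ^ ((q + 1) * k) * p.2 ^ s = ∑ y : F, y ^ (k * q + s) := by
  rw [sum_hermitianPoints_eq_sum_snd, ← sum_trace_pow_mul_pow hF hq2 k s hks]
  refine sum_congr rfl fun y _ => ?_
  have h : ∀ x ∈ univ.filter (fun x : F => x ^ (q + 1) = y ^ q + y),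
      x ^ ((q + 1) * k) * y ^ s = (y ^ q + y) ^ k * y ^ s := by
    intro x hx
    rw [pow_mul, (mem_filter.1 hx).2]
  rw [sum_congr rfl h, sum_const, card_norm_fiber hq2 hF hE]
  split_ifs <;> simp [cast_eq_zero_of_card_eq_sq hF]

theorem sum_hermitianPoints_of_lt (hF : Fintype.card F = q ^ 2) (hq2 : 2 ≤ q)
    (hE : (hermitianPoints F q).card = q ^ 3) {r s : ℕ}
    (h : r * q + s * (q + 1) < (q + 1) * (q ^ 2 - 1)) :
    ∑ p ∈ hermitianPoints F q, p.1 ^ r * p.2 ^ s = 0 := by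
  by_cases hr : (q + 1) ∣ r
  · obtain ⟨k, rfl⟩ := hr
    have hk : k * q + s < q ^ 2 - 1 :=
      Nat.lt_of_mul_lt_mul_left (a := q + 1) (by convert h using 1; ring)
    rw [sum_hermitianPoints_of_mul hF hq2 hE hk.le]
    exact FiniteField.sum_pow_lt_card_sub_one F _ (by rwa [hF])
  · exact sum_hermitianPoints_of_not_dvd hF hq2 hr s

/-- The product of the vertical lines over `A` and the horizontal lines over `B`. -/
def lineProd (A B : Finset F) (p : F × F) : F := (∏ x ∈ A, (p.1 - x)) * ∏ y ∈ B, (p.2 - y)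

theorem lineProd_eq_zero_iff {K : Type} [Field K] {A B : Finset K} {p : K × K} :
    lineProd A B p = 0 ↔ p.1 ∈ A ∨ p.2 ∈ B := by
  simp [lineProd, prod_eq_zero_iff, sub_eq_zero]

theorem sum_hermitianPoints_lineProd (hF : Fintype.card F = q ^ 2) (hq2 : 2 ≤ q)
    (hE : (hermitianPoints F q).card = q ^ 3) (A B : Finset F) : ∀ r s : ℕ,
    (A.card + r) * q + (B.card + s) * (q + 1) ≤ (q + 1) * (q ^ 2 - 1) →
    ∑ p ∈ hermitianPoints F q, lineProd A B p * (p.1 ^ r * p.2 ^ s) =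
      ∑ p ∈ hermitianPoints F q, p.1 ^ (A.card + r) * p.2 ^ (B.card + s) := by
  induction A using Finset.induction_on with
  | empty =>
    induction B using Finset.induction_on with
    | empty => simp [lineProd]
    | insert y B hy ih =>
      intro r s h
      rw [card_insert_of_notMem hy] at h ⊢
      have h1 := ih r (s + 1) (by convert h using 2; ring)
      have hlt : ((∅ : Finset F).card + r) * q + (B.card + s) * (q + 1) <
          (q + 1) * (q ^ 2 - 1) := by nlinarith
      have h0 := ih r s hlt.le
      rw [sum_hermitianPoints_of_lt hF hq2 hE hlt] at h0
      calc _ = ∑ p ∈ hermitianPoints F q, lineProd ∅ B p * (p.1 ^ r * p.2 ^ (s + 1)) -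
            y * ∑ p ∈ hermitianPoints F q, lineProd ∅ B p * (p.1 ^ r * p.2 ^ s) := by
            rw [mul_sum, ← sum_sub_distrib]
            refine sum_congr rfl fun p _ => ?_
            simp only [lineProd, prod_insert hy]
            ring
        _ = _ := by
            rw [h0, h1, mul_zero, sub_zero]
            simp only [add_assoc, add_comm 1 s]
  | insert x A hx ih =>
    intro r s h
    rw [card_insert_of_notMem hx] at h ⊢
    have h1 := ih (r + 1) s (by convert h using 3; ring)
    have hlt : (A.card + r) * q + (B.card + s) * (q + 1) < (q + 1) * (q ^ 2 - 1) := by nlinarith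
    have h0 := ih r s hlt.le
    rw [sum_hermitianPoints_of_lt hF hq2 hE hlt] at h0
    calc _ = ∑ p ∈ hermitianPoints F q, lineProd A B p * (p.1 ^ (r + 1) * p.2 ^ s) -
          x * ∑ p ∈ hermitianPoints F q, lineProd A B p * (p.1 ^ r * p.2 ^ s) := by
          rw [mul_sum, ← sum_sub_distrib]
          refine sum_congr rfl fun p _ => ?_
          simp only [lineProd, prod_insert hx]
          ring
      _ = _ := by
          rw [h0, h1, mul_zero, sub_zero]
          simp only [add_assoc, add_comm 1 r]

theorem card_hermitianPoints_lineProd_eq_zero (hF : Fintype.card F = q ^ 2) (hq2 : 2 ≤ q)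
    (hE : (hermitianPoints F q).card = q ^ 3) {A B : Finset F} (hB : ∀ y ∈ B, y ^ q + y ≠ 0)
    (hAB : ∀ x ∈ A, ∀ y ∈ B, x ^ (q + 1) ≠ y ^ q + y) :
    ((hermitianPoints F q).filter fun p => lineProd A B p = 0).card =
      A.card * q + B.card * (q + 1) := by
  simp only [lineProd_eq_zero_iff]
  rw [filter_or, card_union_of_disjoint]
  · congr 1
    · rw [card_filter, sum_hermitianPoints_eq_sum_fst]
      have h : ∀ x : F, ∑ _y ∈ univ.filter (fun y : F => x ^ (q + 1) = y ^ q + y),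
          (if x ∈ A then 1 else 0) = if x ∈ A then q else 0 := by
        intro x
        rw [sum_const, card_trace_fiber hq2 hF hE]
        simp
      rw [sum_congr rfl fun x _ => h x]
      simp
    · rw [card_filter, sum_hermitianPoints_eq_sum_snd]
      have h : ∀ y : F, ∑ _x ∈ univ.filter (fun x : F => x ^ (q + 1) = y ^ q + y),
          (if y ∈ B then 1 else 0) = if y ∈ B then q + 1 else 0 := by
        intro y
        rw [sum_const, card_norm_fiber hq2 hF hE]
        by_cases hy : y ∈ B
        · simp [hy, hB y hy]
        · simp [hy]
      rw [sum_congr rfl fun y _ => h y]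
      simp
  · rw [disjoint_left]
    rintro ⟨x, y⟩ h1 h2
    simp only [mem_filter, mem_hermitianPoints] at h1 h2
    exact hAB x h1.2 y h2.2 h1.1

end HermitianCurve

/-- A monomial in the initial ideal is divisible by the leading monomial of an element. -/
theorem exists_isLMwith_le_of_mem_initialIdealWith {F : Type} [Field F]
    {lt : ℕ × ℕ → ℕ × ℕ → Prop} {I : Ideal (MvPolynomial (Fin 2) F)} {a b : ℕ}
    (h : monoXY F a b ∈ initialIdealWith lt I) :
    ∃ f ∈ I, ∃ r s, IsLMwith lt f r s ∧ r ≤ a ∧ s ≤ b := by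
  have hset : {g | ∃ f ∈ I, f ≠ 0 ∧ ∃ r s, IsLMwith lt f r s ∧ g = monoXY F r s} =
      (fun d => monomial d (1 : F)) '' {d : Fin 2 →₀ ℕ | ∃ f ∈ I, f ≠ 0 ∧ ∃ r s,
        IsLMwith lt f r s ∧ d = Finsupp.single 0 r + Finsupp.single 1 s} := by
    ext g
    constructor
    · rintro ⟨f, hf, hf0, r, s, hlm, rfl⟩
      exact ⟨_, ⟨f, hf, hf0, r, s, hlm, rfl⟩, (monoXY_eq_monomial F r s).symm⟩
    · rintro ⟨_, ⟨f, hf, hf0, r, s, hlm, rfl⟩, rfl⟩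
      exact ⟨f, hf, hf0, r, s, hlm, (monoXY_eq_monomial F r s).symm⟩
  rw [initialIdealWith, hset, mem_ideal_span_monomial_image, monoXY_eq_monomial] at h
  obtain ⟨_, ⟨f, hf, -, r, s, hlm, rfl⟩, hle⟩ :=
    h (Finsupp.single 0 a + Finsupp.single 1 b) (by simp [mem_support_iff])
  exact ⟨f, hf, r, s, hlm, by simpa using hle 0, by simpa using hle 1⟩

/-- Up to `x`-degree `q`, the order `precOrd` is compatible with the weighted degree. -/
theorem weight_lt_of_precOrd {q a b r s : ℕ} (ha : a ≤ q) (h : precOrd (r, s) (a, b)) :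
    r * q + s * (q + 1) < a * q + b * (q + 1) := by
  rcases h with h | ⟨h1, h2⟩
  · simp only at h
    have := Nat.mul_le_mul_right (q + 1) (Nat.succ_le_of_lt h)
    nlinarith
  · simp only at h1 h2
    have : (r + s) * q = (a + b) * q := by rw [h1]
    nlinarith

/-- Complementing the zeros of a product of lines gives a set whose sous-escalier contains the
monomial dual to the leading monomial of the product. -/
theorem monoXY_notMem_initialIdealWith {q : ℕ} (hq2 : 2 ≤ q) {F : Type} [Field F] [Fintype F]
    (hF : Fintype.card F = q ^ 2) (hE : (hermitianPoints F q).card = q ^ 3) {a b : ℕ}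
    (ha : a ≤ q) {A B : Finset F} {k : ℕ} (hk1 : A.card + a = (q + 1) * k)
    (hk2 : k * q + (B.card + b) = q ^ 2 - 1) :
    monoXY F a b ∉ initialIdealWith precOrd
      (vanIdeal F {p | p ∈ hermitianPoints F q ∧ lineProd A B p ≠ 0}) := by
  intro hmem
  obtain ⟨f, hf, r, s, ⟨hc, hlt⟩, hr, hs⟩ := exists_isLMwith_le_of_mem_initialIdealWith hmem
  have hN : (A.card + a) * q + (B.card + b) * (q + 1) = (q + 1) * (q ^ 2 - 1) := by
    rw [hk1, ← hk2]
    ring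
  have hzero : ∑ p ∈ hermitianPoints F q,
      lineProd A B p * (p.1 ^ (a - r) * p.2 ^ (b - s)) * evalPt p f = 0 := by
    refine Finset.sum_eq_zero fun p hp => ?_
    by_cases h0 : lineProd A B p = 0
    · simp [h0]
    · rw [hf p ⟨hp, h0⟩, mul_zero]
  have hexp : ∑ p ∈ hermitianPoints F q,
      lineProd A B p * (p.1 ^ (a - r) * p.2 ^ (b - s)) * evalPt p f =
      ∑ d ∈ f.support, coeff d f * ∑ p ∈ hermitianPoints F q,
        lineProd A B p * (p.1 ^ (a - r + d 0) * p.2 ^ (b - s + d 1)) := by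
    simp only [evalPt, eval_eq', Finset.mul_sum]
    rw [Finset.sum_comm]
    refine Finset.sum_congr rfl fun d _ => Finset.sum_congr rfl fun p _ => ?_
    simp only [Fin.prod_univ_two, Matrix.cons_val_zero, Matrix.cons_val_one, pow_add]
    ring
  rw [hexp, Finset.sum_eq_single (Finsupp.single 0 r + Finsupp.single 1 s)] at hzero
  · have h0 : a - r + (Finsupp.single 0 r + Finsupp.single 1 s : Fin 2 →₀ ℕ) 0 = a := by
      simp [hr]
    have h1 : b - s + (Finsupp.single 0 r + Finsupp.single 1 s : Fin 2 →₀ ℕ) 1 = b := by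
      simp [hs]
    rw [h0, h1, sum_hermitianPoints_lineProd hF hq2 hE A B a b hN.le, hk1,
      sum_hermitianPoints_of_mul hF hq2 hE hk2.le, hk2, sum_pow_card_sub_one hF hq2] at hzero
    simp [hc] at hzero
  · intro d hd hne
    have hprec : precOrd (d 0, d 1) (r, s) := by
      refine (hlt d hd).resolve_left fun h => hne ?_
      simp only [expPair, Prod.mk.injEq] at h
      ext i
      fin_cases i <;> simp [h.1, h.2]
    have hprec' : precOrd (a - r + d 0, b - s + d 1) (a, b) := by
      simp only [precOrd] at hprec ⊢
      omega
    have hw := weight_lt_of_precOrd ha hprec'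
    have hlt' : (A.card + (a - r + d 0)) * q + (B.card + (b - s + d 1)) * (q + 1) <
        (q + 1) * (q ^ 2 - 1) := by
      rw [← hN]
      linarith
    rw [sum_hermitianPoints_lineProd hF hq2 hE A B _ _ hlt'.le,
      sum_hermitianPoints_of_lt hF hq2 hE hlt', mul_zero]
  · intro h
    exact absurd (notMem_support_iff.1 h) hc

/-- Sets of vertical and horizontal lines with simple, pairwise distinct rational intersections
with the curve, dual to a given monomial. -/
theorem exists_dual_lines {q : ℕ} (hq2 : 2 ≤ q) {F : Type} [Field F] [Fintype F]
    (hF : Fintype.card F = q ^ 2) (hE : (hermitianPoints F q).card = q ^ 3) {a b : ℕ}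
    (hab : (a, b) ∈ Bset q) (hw : 2 * q ^ 2 - 2 * q - 1 ≤ a * q + b * (q + 1)) :
    ∃ (A B : Finset F) (k : ℕ), A.card + a = (q + 1) * k ∧
      k * q + (B.card + b) = q ^ 2 - 1 ∧ (∀ y ∈ B, y ^ q + y ≠ 0) ∧
      ∀ x ∈ A, ∀ y ∈ B, x ^ (q + 1) ≠ y ^ q + y := by
  classical
  have hqq : 2 * q ≤ q ^ 2 := by nlinarith
  have hcard := card_trace_ne_zero hq2 hF hE
  rcases Nat.eq_zero_or_pos a with rfl | ha
  · have hb : b ≤ q ^ 2 - 1 := by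
      simp only [Bset, Set.mem_ofPred_eq] at hab
      omega
    have hb' : q ≤ b + 1 := by
      by_contra! h
      have h1 : (b + 2) * (q + 1) ≤ q * (q + 1) := Nat.mul_le_mul_right _ h
      have h2 : 2 * q ^ 2 ≤ b * (q + 1) + (2 * q + 1) := by omega
      nlinarith
    obtain ⟨B, hB, hBc⟩ := Finset.exists_subset_card_eq
      (show q ^ 2 - 1 - b ≤ (Finset.univ.filter fun y : F => y ^ q + y ≠ 0).card by omega)
    refine ⟨∅, B, 0, by simp, by omega, fun y hy => by simpa using hB hy, by simp⟩
  · have haq : a ≤ q ∧ b ≤ q ^ 2 - q - 1 := by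
      simp only [Bset, Set.mem_ofPred_eq] at hab
      omega
    have hw' : 2 * q ^ 2 ≤ a * q + b * (q + 1) + (2 * q + 1) := by omega
    by_cases hb : q ≤ b + 1
    · obtain ⟨y₀, hy₀⟩ : ∃ y₀ : F, y₀ ^ q + y₀ ≠ 0 := by
        have hpos : 0 < (Finset.univ.filter fun y : F => y ^ q + y ≠ 0).card := by omega
        obtain ⟨y, hy⟩ := Finset.card_pos.1 hpos
        exact ⟨y, by simpa using hy⟩
      have hnorm := card_norm_fiber hq2 hF hE y₀
      rw [if_neg hy₀] at hnorm
      obtain ⟨A, hA, hAc⟩ := Finset.exists_subset_card_eq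
        (show q + 1 - a ≤ (Finset.univ.filter fun x : F => x ^ (q + 1) = y₀ ^ q + y₀).card by omega)
      have hA' : ∀ x ∈ A, x ^ (q + 1) = y₀ ^ q + y₀ := fun x hx => by simpa using hA hx
      obtain ⟨x₀, hx₀⟩ : A.Nonempty := Finset.card_pos.1 (by omega)
      have htr := card_trace_fiber hq2 hF hE x₀
      have hsdiff := Finset.le_card_sdiff
        (Finset.univ.filter fun y : F => x₀ ^ (q + 1) = y ^ q + y)
        (Finset.univ.filter fun y : F => y ^ q + y ≠ 0)
      rw [htr, hcard] at hsdiff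
      obtain ⟨B, hB, hBc⟩ := Finset.exists_subset_card_eq
        (show q ^ 2 - q - 1 - b ≤ _ from le_trans (by omega) hsdiff)
      have hB' : ∀ y ∈ B, y ^ q + y ≠ 0 ∧ x₀ ^ (q + 1) ≠ y ^ q + y :=
        fun y hy => by simpa using hB hy
      refine ⟨A, B, 1, by omega, by omega, fun y hy => (hB' y hy).1, fun x hx y hy => ?_⟩
      rw [hA' x hx, ← hA' x₀ hx₀]
      exact (hB' y hy).2
    · push Not at hb
      have haq' : a = q := by
        by_contra hne
        have h1 : (b + 2) * (q + 1) ≤ q * (q + 1) := Nat.mul_le_mul_right _ hb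
        have h2 : (a + 1) * q ≤ q * q := Nat.mul_le_mul_right _ (by omega)
        nlinarith
      obtain ⟨B, hB, hBc⟩ := Finset.exists_subset_card_eq
        (show q ^ 2 - q - 1 - b ≤ (Finset.univ.filter fun y : F => y ^ q + y ≠ 0).card by omega)
      have hB' : ∀ y ∈ B, y ^ q + y ≠ 0 := fun y hy => by simpa using hB hy
      refine ⟨{0}, B, 1, by simp [haq', add_comm], by omega, hB', fun x hx y hy => ?_⟩
      rw [Finset.mem_singleton.1 hx, zero_pow (by omega)]
      exact (hB' y hy).symm

theorem stmt_15 (q : ℕ) (hq2 : 2 ≤ q) (hq : IsPrimePow q)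
    (F : Type) [Field F] [Fintype F] (hF : Fintype.card F = q ^ 2)
    (P : Fin (q ^ 3) → F × F) (hPinj : Function.Injective P)
    (hPrange : Set.range P = Eset F q)
    (m : ℕ) (hm : 2 * q ^ 2 - 2 * q - 2 ≤ m)
    (a b : ℕ) (hab : (a, b) ∈ Bset q)
    (hw1 : m + 1 ≤ a * q + b * (q + 1)) (hw2 : a * q + b * (q + 1) ≤ m + q + 1) :
    ∃ D' : Set (F × F), D' ⊆ Eset F q ∧
      monoXY F a b ∉ initialIdealWith precOrd (vanIdeal F D') ∧
      D'.ncard + (q ^ 2 - q) = a * q + b * (q + 1) + 1 ∧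
      ∃ c ∈ codeSet F q m P, c ≠ 0 ∧ suppPts P c ⊆ D' := by
  classical
  have hqq : 2 * q ≤ q ^ 2 := by nlinarith
  have hmemE : ∀ p : F × F, p ∈ hermitianPoints F q ↔ p ∈ Set.range P := fun p => by
    rw [hPrange, mem_hermitianPoints, Eset, Set.mem_ofPred_eq]
  have hmap : hermitianPoints F q = Finset.univ.map ⟨P, hPinj⟩ := by
    ext p
    simp [hmemE]
  have hE : (hermitianPoints F q).card = q ^ 3 := by simp [hmap]
  obtain ⟨A, B, k, hk1, hk2, hB, hAB⟩ :=
    exists_dual_lines hq2 hF hE hab (by omega : 2 * q ^ 2 - 2 * q - 1 ≤ a * q + b * (q + 1))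
  have haq : a ≤ q := by
    simp only [Bset, Set.mem_ofPred_eq] at hab
    omega
  have hN : (A.card + a) * q + (B.card + b) * (q + 1) = (q + 1) * (q ^ 2 - 1) := by
    rw [hk1, ← hk2]
    ring
  have hN' : (q + 1) * (q ^ 2 - 1) + q + 1 = q ^ 3 + q ^ 2 := by
    zify [show 1 ≤ q ^ 2 by omega]
    ring
  have hcard : {p | p ∈ hermitianPoints F q ∧ lineProd A B p ≠ 0}.ncard + (q ^ 2 - q) =
      a * q + b * (q + 1) + 1 := by
    have h := Finset.card_filter_add_card_filter_not (s := hermitianPoints F q)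
      fun p => lineProd A B p = 0
    rw [card_hermitianPoints_lineProd_eq_zero hF hq2 hE hB hAB, hE] at h
    rw [← Finset.coe_filter, Set.ncard_coe_finset]
    simp only [ne_eq]
    rw [add_mul, add_mul] at hN
    omega
  refine ⟨{p | p ∈ hermitianPoints F q ∧ lineProd A B p ≠ 0}, ?_,
    monoXY_notMem_initialIdealWith hq2 hF hE haq hk1 hk2, hcard,
    fun i => lineProd A B (P i), ?_, ?_, ?_⟩
  · rintro p ⟨hp, -⟩
    rw [← hPrange]
    exact (hmemE p).1 hp
  · intro r s hrs
    have hlt : (A.card + r) * q + (B.card + s) * (q + 1) < (q + 1) * (q ^ 2 - 1) := by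
      rw [← hN]
      linarith
    have h := sum_hermitianPoints_lineProd hF hq2 hE A B r s hlt.le
    rw [sum_hermitianPoints_of_lt hF hq2 hE hlt, hmap, Finset.sum_map] at h
    exact h
  · intro h0
    have hne : {p | p ∈ hermitianPoints F q ∧ lineProd A B p ≠ 0}.ncard ≠ 0 := by
      have : q ^ 2 ≥ q := by omega
      omega
    obtain ⟨p, hp, hp0⟩ := Set.nonempty_of_ncard_ne_zero hne
    obtain ⟨i, rfl⟩ := (hmemE p).1 hp
    exact hp0 (congrFun h0 i)
  · rintro _ ⟨i, hi, rfl⟩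
    exact ⟨(hmemE _).2 ⟨i, rfl⟩, hi⟩
end

section
/- Let f ∈ F[x,y] be a polynomial with LM_≺(f) = x^{μ} y^{λ} and assume that both x^{q^2} - x and y^{q^2} - y belong to the ideal ⟨H, f⟩. Let D := {P ∈ F^2 : H(P) = 0 and f(P) = 0}. Then D ⊆ E, |D| = d, and there exists a nonzero codeword c ∈ C_m of minimum weight d with Supp(c) = D. -/
open MvPolynomial

namespace HermitianCode

/-- The weighted degree of the exponent `e`, where `x` and `y` have weights `q` and `q + 1`. -/
def wdeg (q : ℕ) (e : Fin 2 →₀ ℕ) : ℕ := e 0 * q + e 1 * (q + 1)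

/-- The numerical semigroup generated by `q` and `q + 1`. -/
def semigroup (q : ℕ) : Set ℕ := {k | ∃ r s, r * q + s * (q + 1) = k}

lemma add_mem_semigroup {q a b : ℕ} (ha : a ∈ semigroup q) (hb : b ∈ semigroup q) :
    a + b ∈ semigroup q := by
  obtain ⟨r, s, rfl⟩ := ha
  obtain ⟨r', s', rfl⟩ := hb
  exact ⟨r + r', s + s', by ring⟩

lemma exists_le_of_mem_semigroup {q k : ℕ} (hk : k ∈ semigroup q) :
    ∃ r s, r ≤ q ∧ r * q + s * (q + 1) = k := by
  obtain ⟨r, s, rfl⟩ := hk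
  refine ⟨r % (q + 1), s + r / (q + 1) * q, Nat.lt_succ_iff.1 (Nat.mod_lt _ (by omega)), ?_⟩
  conv_rhs => rw [← Nat.mod_add_div r (q + 1)]
  ring

lemma eq_of_weight_eq {q r s r' s' : ℕ} (hr : r ≤ q) (hr' : r' ≤ q)
    (h : r * q + s * (q + 1) = r' * q + s' * (q + 1)) : r = r' ∧ s = s' := by
  have hz : ((r : ℤ) - r') = (q + 1) * (r + s - r' - s') := by
    have : ((r * q + s * (q + 1) : ℕ) : ℤ) = ((r' * q + s' * (q + 1) : ℕ) : ℤ) := by rw [h]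
    push_cast at this
    linear_combination -this
  have h0 : ((r : ℤ) - r') = 0 := by
    refine Int.eq_zero_of_abs_lt_dvd (m := (q : ℤ) + 1) ⟨_, hz⟩ ?_
    rw [abs_lt]
    constructor <;> linarith [(Nat.cast_nonneg r : (0 : ℤ) ≤ r),
      (Nat.cast_nonneg r' : (0 : ℤ) ≤ r'), (Nat.cast_le (α := ℤ)).2 hr,
      (Nat.cast_le (α := ℤ)).2 hr']
  have hrr : r = r' := by omega
  subst hrr
  refine ⟨rfl, ?_⟩
  have : s * (q + 1) = s' * (q + 1) := by omega
  exact Nat.eq_of_mul_eq_mul_right (by omega) this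

lemma compl_mem_semigroup {q t : ℕ} (ht : t ∉ semigroup q) :
    ∃ u ∈ semigroup q, u + t + q + 1 = q ^ 2 := by
  obtain ⟨s, hs⟩ : ∃ s : ℤ, (t : ℤ) - ((q * t % (q + 1) : ℕ) : ℤ) * q = (q + 1) * s := by
    have h1 := Nat.mod_add_div (q * t) (q + 1)
    have h2 : ((q * t % (q + 1) : ℕ) : ℤ) + (q + 1) * ((q * t / (q + 1) : ℕ) : ℤ) = q * t := by
      exact_mod_cast h1
    exact ⟨(t : ℤ) - q * t + q * ((q * t / (q + 1) : ℕ) : ℤ), by linear_combination (-(q : ℤ)) * h2⟩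
  have hr : q * t % (q + 1) ≤ q := Nat.lt_succ_iff.1 (Nat.mod_lt _ (by omega))
  generalize q * t % (q + 1) = r at hs hr
  have hneg : s < 0 := by
    by_contra! h
    lift s to ℕ using h
    refine ht ⟨r, s, ?_⟩
    zify
    linear_combination -hs
  obtain ⟨v, hv⟩ : ∃ v : ℕ, s = -1 - v := ⟨(-1 - s).toNat, by omega⟩
  obtain ⟨w, rfl⟩ := Nat.exists_eq_add_of_le hr
  refine ⟨_, ⟨w, v, rfl⟩, ?_⟩
  subst hv
  zify
  push_cast at hs
  linear_combination hs

lemma mem_semigroup_of_le {q t : ℕ} (ht : q ^ 2 ≤ t) : t ∈ semigroup q := by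
  by_contra h
  obtain ⟨u, -, hu⟩ := compl_mem_semigroup h
  omega

lemma frobenius_notMem_semigroup {q t : ℕ} (ht : t + q + 1 = q ^ 2) : t ∉ semigroup q := by
  rintro ⟨r, s, rfl⟩
  obtain ⟨r, s, hr, h⟩ := exists_le_of_mem_semigroup ⟨r, s, rfl⟩
  rw [← h] at ht
  have := eq_of_weight_eq (r := r) (s := s + 1) (r' := q) (s' := 0) hr le_rfl (by linarith)
  omega

open Classical in
/-- The Apéry set of the semigroup generated by `q` and `q + 1` with respect to `d`. -/
noncomputable def apery (q d : ℕ) : Finset ℕ :=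
  (Finset.range (q ^ 2 + d)).filter fun k => k ∈ semigroup q ∧ ∀ l ∈ semigroup q, l + d ≠ k

lemma mem_apery {q d k : ℕ} :
    k ∈ apery q d ↔ k ∈ semigroup q ∧ ∀ l ∈ semigroup q, l + d ≠ k := by
  simp only [apery, Finset.mem_filter, Finset.mem_range, and_iff_right_iff_imp]
  rintro ⟨-, h⟩
  by_contra! hk
  exact h (k - d) (mem_semigroup_of_le (by omega)) (by omega)

lemma card_apery {q d : ℕ} (hd : d ∈ semigroup q) : (apery q d).card = d := by
  classical
  set S := (Finset.range (q ^ 2)).filter (· ∈ semigroup q)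
  have h1 : (Finset.range (q ^ 2 + d)).filter (· ∈ semigroup q) =
      S ∪ Finset.Ico (q ^ 2) (q ^ 2 + d) := by
    ext k
    simp only [S, Finset.mem_filter, Finset.mem_range, Finset.mem_union, Finset.mem_Ico]
    constructor
    · rintro ⟨h, h'⟩
      by_cases hk : k < q ^ 2
      · exact Or.inl ⟨hk, h'⟩
      · exact Or.inr ⟨by omega, h⟩
    · rintro (⟨h, h'⟩ | ⟨h, h'⟩)
      · exact ⟨by omega, h'⟩
      · exact ⟨h', mem_semigroup_of_le h⟩
  have h2 : (Finset.range (q ^ 2 + d)).filter (· ∈ semigroup q) =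
      apery q d ∪ S.map (addRightEmbedding d) := by
    ext k
    simp only [S, Finset.mem_filter, Finset.mem_range, Finset.mem_union, Finset.mem_map,
      addRightEmbedding_apply, mem_apery]
    constructor
    · rintro ⟨h, h'⟩
      by_cases hk : ∃ l ∈ semigroup q, l + d = k
      · obtain ⟨l, hl, rfl⟩ := hk
        exact Or.inr ⟨l, ⟨by omega, hl⟩, rfl⟩
      · push Not at hk
        exact Or.inl ⟨h', hk⟩
    · rintro (⟨h, h'⟩ | ⟨l, ⟨h, h'⟩, rfl⟩)
      · refine ⟨?_, h⟩
        by_contra! hk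
        exact h' (k - d) (mem_semigroup_of_le (by omega)) (by omega)
      · exact ⟨by omega, add_mem_semigroup h' hd⟩
  have h3 : Disjoint S (Finset.Ico (q ^ 2) (q ^ 2 + d)) := by
    rw [Finset.disjoint_left]
    intro k hk hk'
    simp only [S, Finset.mem_filter, Finset.mem_range, Finset.mem_Ico] at hk hk'
    omega
  have h4 : Disjoint (apery q d) (S.map (addRightEmbedding d)) := by
    rw [Finset.disjoint_left]
    intro k hk hk'
    simp only [S, Finset.mem_filter, Finset.mem_map, addRightEmbedding_apply] at hk'
    obtain ⟨l, ⟨-, hl⟩, h⟩ := hk'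
    exact (mem_apery.1 hk).2 l hl h
  have h5 := congrArg Finset.card (h1.symm.trans h2)
  rw [Finset.card_union_of_disjoint h3, Finset.card_union_of_disjoint h4, Finset.card_map,
    Nat.card_Ico] at h5
  omega

lemma top_mem_apery {q d M : ℕ} (hd : 0 < d) (hM : M + q + 1 = q ^ 2 + d) : M ∈ apery q d := by
  rw [mem_apery]
  constructor
  · by_contra h
    obtain ⟨u, -, hu⟩ := compl_mem_semigroup h
    omega
  · rintro l hl rfl
    exact frobenius_notMem_semigroup (by omega) hl

lemma exists_compl_of_mem_apery {q d M n : ℕ} (hM : M + q + 1 = q ^ 2 + d)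
    (hn : n ∈ apery q d) : ∃ l ∈ semigroup q, l + n = M := by
  rw [mem_apery] at hn
  by_cases h : n < d
  · refine ⟨M - n, ?_, ?_⟩
    · by_contra hc
      obtain ⟨u, -, hu⟩ := compl_mem_semigroup hc
      have : q + 1 ≤ q ^ 2 + d := by omega
      omega
    · by_contra hc
      have h1 : q ^ 2 ≤ q := by omega
      have h2 : q ≤ 1 := by nlinarith
      interval_cases q <;> omega
  · obtain ⟨u, hu, hu'⟩ := compl_mem_semigroup (q := q) (t := n - d)
      fun hc => hn.2 _ hc (by omega)
    exact ⟨u, hu, by omega⟩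

section Reduction

variable {F : Type} [Field F] {q : ℕ}

variable (F q) in
/-- The polynomials all of whose monomials have weighted degree less than `k`. -/
noncomputable def weightLT (k : ℕ) : Submodule F (MvPolynomial (Fin 2) F) :=
  restrictSupport F {e | wdeg q e < k}

variable (F q) in
/-- The polynomials of degree at most `q` in `x`. -/
noncomputable def reduced : Submodule F (MvPolynomial (Fin 2) F) :=
  restrictSupport F {e | e 0 ≤ q}

variable (F q) in
/-- The substitution `x ↦ T ^ q`, `y ↦ T ^ (q + 1)`. -/
noncomputable def symbol : MvPolynomial (Fin 2) F →ₐ[F] Polynomial F :=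
  aeval ![Polynomial.X ^ q, Polynomial.X ^ (q + 1)]

lemma wdeg_add (e e' : Fin 2 →₀ ℕ) : wdeg q (e + e') = wdeg q e + wdeg q e' := by
  simp only [wdeg, Finsupp.add_apply]
  ring

lemma mem_weightLT {k : ℕ} {p : MvPolynomial (Fin 2) F} :
    p ∈ weightLT F q k ↔ ∀ e ∈ p.support, wdeg q e < k := Iff.rfl

lemma mem_reduced {p : MvPolynomial (Fin 2) F} :
    p ∈ reduced F q ↔ ∀ e ∈ p.support, e 0 ≤ q := Iff.rfl

lemma monomial_mem_weightLT {k : ℕ} {e : Fin 2 →₀ ℕ} (a : F) (h : wdeg q e < k) :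
    monomial e a ∈ weightLT F q k := by
  rw [weightLT, monomial_mem_restrictSupport]
  exact Or.inl h

lemma monomial_mem_reduced {e : Fin 2 →₀ ℕ} (a : F) (h : e 0 ≤ q) :
    monomial e a ∈ reduced F q := by
  rw [reduced, monomial_mem_restrictSupport]
  exact Or.inl h

lemma exists_mem_weightLT (q : ℕ) (p : MvPolynomial (Fin 2) F) :
    ∃ k, p ∈ weightLT F q (k + 1) :=
  ⟨p.support.sup (wdeg q), fun _ he => Nat.lt_succ_iff.2 (Finset.le_sup he)⟩

lemma mul_mem_weightLT {k l : ℕ} {p r : MvPolynomial (Fin 2) F}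
    (hp : p ∈ weightLT F q (k + 1)) (hr : r ∈ weightLT F q (l + 1)) :
    p * r ∈ weightLT F q (k + l + 1) := by
  intro e he
  obtain ⟨a, ha, b, hb, rfl⟩ := Finset.mem_add.1 (support_mul p r he)
  have h1 := mem_weightLT.1 hp a ha
  have h2 := mem_weightLT.1 hr b hb
  simp only [Set.mem_ofPred_eq, wdeg_add]
  omega

lemma symbol_monomial (e : Fin 2 →₀ ℕ) (a : F) :
    symbol F q (monomial e a) = Polynomial.monomial (wdeg q e) a := by
  rw [symbol, aeval_monomial, Finsupp.prod_fintype _ _ (by simp), ← Polynomial.C_mul_X_pow_eq_monomial]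
  simp only [Fin.prod_univ_two, Matrix.cons_val_zero, Matrix.cons_val_one, ← pow_mul, ← pow_add,
    Polynomial.algebraMap_eq, wdeg]
  rw [mul_comm q, mul_comm (q + 1)]

lemma coeff_symbol (p : MvPolynomial (Fin 2) F) (n : ℕ) :
    (symbol F q p).coeff n = ∑ e ∈ p.support, if wdeg q e = n then coeff e p else 0 := by
  conv_lhs => rw [p.as_sum]
  simp only [map_sum, symbol_monomial, Polynomial.finsetSum_coeff, Polynomial.coeff_monomial]

lemma natDegree_symbol_le {k : ℕ} {p : MvPolynomial (Fin 2) F} (hp : p ∈ weightLT F q (k + 1)) :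
    (symbol F q p).natDegree ≤ k := by
  rw [Polynomial.natDegree_le_iff_coeff_eq_zero]
  intro n hn
  rw [coeff_symbol]
  refine Finset.sum_eq_zero fun e he => if_neg ?_
  have := mem_weightLT.1 hp e he
  omega

lemma coeff_symbol_mul {k l : ℕ} {p r : MvPolynomial (Fin 2) F}
    (hp : p ∈ weightLT F q (k + 1)) (hr : r ∈ weightLT F q (l + 1)) :
    (symbol F q (p * r)).coeff (k + l) = (symbol F q p).coeff k * (symbol F q r).coeff l := by
  rw [map_mul, Polynomial.coeff_mul_add_eq_of_natDegree_le (natDegree_symbol_le hp)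
    (natDegree_symbol_le hr)]

lemma eq_of_wdeg_eq {e e' : Fin 2 →₀ ℕ} (he : e 0 ≤ q) (he' : e' 0 ≤ q)
    (h : wdeg q e = wdeg q e') : e = e' := by
  obtain ⟨h0, h1⟩ := eq_of_weight_eq he he' h
  ext i
  fin_cases i
  · exact h0
  · exact h1

lemma coeff_symbol_of_mem_reduced {p : MvPolynomial (Fin 2) F} (hp : p ∈ reduced F q)
    {e : Fin 2 →₀ ℕ} (he : e 0 ≤ q) : (symbol F q p).coeff (wdeg q e) = coeff e p := by
  rw [coeff_symbol, Finset.sum_eq_single e, if_pos rfl]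
  · exact fun e' he' hne => if_neg fun h => hne (eq_of_wdeg_eq (mem_reduced.1 hp e' he') he h)
  · intro h
    rw [if_pos rfl, notMem_support_iff.1 h]

lemma eq_zero_of_symbol_eq_zero {p : MvPolynomial (Fin 2) F} (hp : p ∈ reduced F q)
    (h : symbol F q p = 0) : p = 0 := by
  by_contra hne
  obtain ⟨e, he⟩ := Finset.nonempty_iff_ne_empty.2 (mt support_eq_empty.1 hne)
  have := coeff_symbol_of_mem_reduced hp (mem_reduced.1 hp e he)
  rw [h, Polynomial.coeff_zero] at this
  exact mem_support_iff.1 he this.symm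

lemma mem_weightLT_of_mem_reduced {p : MvPolynomial (Fin 2) F} (hp : p ∈ reduced F q) :
    p ∈ weightLT F q ((symbol F q p).natDegree + 1) := by
  intro e he
  refine Nat.lt_succ_iff.2 (Polynomial.le_natDegree_of_ne_zero ?_)
  rw [coeff_symbol_of_mem_reduced hp (mem_reduced.1 hp e he)]
  exact mem_support_iff.1 he

lemma natDegree_symbol_mem_semigroup {p : MvPolynomial (Fin 2) F} (hp : p ≠ 0)
    (hr : p ∈ reduced F q) : (symbol F q p).natDegree ∈ semigroup q := by
  by_contra h
  have h0 : (symbol F q p).leadingCoeff = 0 := by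
    rw [Polynomial.leadingCoeff, coeff_symbol]
    exact Finset.sum_eq_zero fun e _ => if_neg fun he => h ⟨_, _, he⟩
  exact hp (eq_zero_of_symbol_eq_zero hr (Polynomial.leadingCoeff_eq_zero.1 h0))

lemma exists_reduced_monoXY (hq : 2 ≤ q) (k a : ℕ) : ∀ b, a * q + b * (q + 1) ≤ k →
    ∃ p ∈ weightLT F q (k + 1), p ∈ reduced F q ∧ monoXY F a b - p ∈ Ideal.span {Hpoly F q} ∧
      (symbol F q p).coeff k = (symbol F q (monoXY F a b)).coeff k := by
  induction a using Nat.strong_induction_on with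
  | _ a ih =>
    intro b hk
    by_cases ha : a ≤ q
    · have h : monoXY F a b = monomial (Finsupp.single 0 a + Finsupp.single 1 b) 1 := by
        rw [monoXY, X_pow_eq_monomial, X_pow_eq_monomial, monomial_mul, one_mul]
      refine ⟨monoXY F a b, ?_, ?_, by simp, rfl⟩
      · rw [h]
        exact monomial_mem_weightLT _ (by simpa [wdeg, Nat.lt_succ_iff] using hk)
      · rw [h]
        exact monomial_mem_reduced _ (by simpa using ha)
    · obtain ⟨c, rfl⟩ : ∃ c, a = c + (q + 1) := ⟨a - (q + 1), by omega⟩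
      have hw : c * q + (b + 1) * (q + 1) < k := by nlinarith
      have hw' : c * q + (b + q) * (q + 1) ≤ k := by nlinarith
      obtain ⟨p₁, h1, h2, h3, h4⟩ := ih c (by omega) (b + q) hw'
      obtain ⟨p₂, h1', h2', h3', h4'⟩ := ih c (by omega) (b + 1) hw.le
      have key : monoXY F (c + (q + 1)) b =
          monoXY F c (b + q) + monoXY F c (b + 1) + monoXY F c b * Hpoly F q := by
        simp only [monoXY, Hpoly]
        ring
      refine ⟨p₁ + p₂, add_mem h1 h1', add_mem h2 h2', ?_, ?_⟩
      · rw [key, show monoXY F c (b + q) + monoXY F c (b + 1) + monoXY F c b * Hpoly F q -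
          (p₁ + p₂) = (monoXY F c (b + q) - p₁) + (monoXY F c (b + 1) - p₂) +
            monoXY F c b * Hpoly F q by ring]
        exact add_mem (add_mem h3 h3')
          (Ideal.mul_mem_left _ _ (Ideal.mem_span_singleton_self _))
      · have h5 : symbol F q (monoXY F c b * Hpoly F q) =
            -Polynomial.X ^ (c * q + (b + 1) * (q + 1)) := by
          simp only [symbol, monoXY, Hpoly, map_mul, map_sub, map_pow, aeval_X,
            Matrix.cons_val_zero, Matrix.cons_val_one]
          ring
        rw [key, map_add, map_add, map_add, Polynomial.coeff_add, Polynomial.coeff_add,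
          Polynomial.coeff_add, h4, h4', h5, Polynomial.coeff_neg, Polynomial.coeff_X_pow,
          if_neg hw.ne', neg_zero, add_zero]

lemma exists_reduced (hq : 2 ≤ q) {k : ℕ} {p : MvPolynomial (Fin 2) F}
    (hp : p ∈ weightLT F q (k + 1)) :
    ∃ p' ∈ weightLT F q (k + 1), p' ∈ reduced F q ∧ p - p' ∈ Ideal.span {Hpoly F q} ∧
      (symbol F q p').coeff k = (symbol F q p).coeff k := by
  rw [weightLT, restrictSupport_eq_span] at hp
  induction hp using Submodule.span_induction with
  | mem x hx =>
    obtain ⟨e, he, rfl⟩ := hx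
    have h : monomial e (1 : F) = monoXY F (e 0) (e 1) := by
      rw [monoXY, monomial_eq, Finsupp.prod_fintype _ _ (by simp), Fin.prod_univ_two, C_1, one_mul]
    simp only [h]
    exact exists_reduced_monoXY hq k _ _ (Nat.lt_succ_iff.1 he)
  | zero => exact ⟨0, zero_mem _, zero_mem _, by simp, rfl⟩
  | add x y _ _ hx hy =>
    obtain ⟨x', h1, h2, h3, h4⟩ := hx
    obtain ⟨y', h1', h2', h3', h4'⟩ := hy
    refine ⟨x' + y', add_mem h1 h1', add_mem h2 h2', ?_, by simp [h4, h4']⟩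
    rw [add_sub_add_comm]
    exact add_mem h3 h3'
  | smul a x _ hx =>
    obtain ⟨x', h1, h2, h3, h4⟩ := hx
    refine ⟨a • x', Submodule.smul_mem _ _ h1, Submodule.smul_mem _ _ h2, ?_, by simp [h4]⟩
    rw [← smul_sub, smul_eq_C_mul]
    exact Ideal.mul_mem_left _ _ h3

lemma exists_lower_weight (hq : 2 ≤ q) {k : ℕ} {p : MvPolynomial (Fin 2) F}
    (hp : p ∈ weightLT F q (k + 1)) (h0 : (symbol F q p).coeff k = 0) :
    ∃ p' ∈ weightLT F q k, p - p' ∈ Ideal.span {Hpoly F q} := by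
  obtain ⟨p', h1, h2, h3, h4⟩ := exists_reduced hq hp
  refine ⟨p', fun e he => lt_of_le_of_ne (Nat.lt_succ_iff.1 (h1 he)) ?_, h3⟩
  rintro rfl
  rw [coeff_symbol_of_mem_reduced h2 (mem_reduced.1 h2 e he), h0] at h4
  exact mem_support_iff.1 he h4

lemma eq_zero_of_mem_span_Hpoly {p : MvPolynomial (Fin 2) F} (hp : p ∈ reduced F q)
    (h : p ∈ Ideal.span {Hpoly F q}) : p = 0 := by
  by_contra hne
  obtain ⟨r, rfl⟩ := Ideal.mem_span_singleton.1 h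
  have hr := right_ne_zero_of_mul hne
  have hH := left_ne_zero_of_mul hne
  have h1 : q + 1 ≤ degreeOf 0 (Hpoly F q) := by
    have : Finsupp.single 0 (q + 1) ∈ (Hpoly F q).support := by
      have h1 : (Finsupp.single 1 q : Fin 2 →₀ ℕ) ≠ Finsupp.single 0 (q + 1) := by
        intro h
        have := DFunLike.congr_fun h 0
        simp at this
      have h2 : (Finsupp.single 1 1 : Fin 2 →₀ ℕ) ≠ Finsupp.single 0 (q + 1) := by
        intro h
        have := DFunLike.congr_fun h 0
        simp at this
      rw [mem_support_iff, Hpoly, coeff_sub, coeff_sub, coeff_X_pow, coeff_X_pow, coeff_X,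
        if_pos rfl, if_neg h1, if_neg h2]
      simp
    simpa using monomial_le_degreeOf 0 this
  have h2 : degreeOf 0 (Hpoly F q * r) ≤ q := degreeOf_le_iff.2 fun e he => mem_reduced.1 hp e he
  rw [degreeOf_mul_eq hH hr] at h2
  omega

lemma exists_natDegree_symbol_eq (hq : 2 ≤ q) {d : ℕ} {f g : MvPolynomial (Fin 2) F}
    (hf : f ∈ weightLT F q (d + 1)) (hfd : (symbol F q f).coeff d ≠ 0) (hg : g ∈ reduced F q)
    (hgJ : g ∈ Ideal.span {Hpoly F q, f}) (hg0 : g ≠ 0) :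
    ∃ l ∈ semigroup q, l + d = (symbol F q g).natDegree := by
  obtain ⟨a, b, rfl⟩ := Ideal.mem_span_pair.1 hgJ
  obtain ⟨k, hk⟩ := exists_mem_weightLT q b
  obtain ⟨b', -, hb', hbb, -⟩ := exists_reduced hq hk
  by_cases hb0 : b' = 0
  · refine absurd (eq_zero_of_mem_span_Hpoly hg ?_) hg0
    rw [hb0, sub_zero] at hbb
    exact add_mem (Ideal.mul_mem_left _ _ (Ideal.mem_span_singleton_self _))
      (Ideal.mul_mem_right _ _ hbb)
  have hbw := mem_weightLT_of_mem_reduced hb'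
  have hbl : (symbol F q b').leadingCoeff ≠ 0 :=
    Polynomial.leadingCoeff_ne_zero.2 (mt (eq_zero_of_symbol_eq_zero hb') hb0)
  have hc := coeff_symbol_mul hbw hf
  obtain ⟨p, hp1, hp2, hp3, hp4⟩ := exists_reduced hq (mul_mem_weightLT hbw hf)
  have hpg : p = a * Hpoly F q + b * f := by
    rw [eq_comm, ← sub_eq_zero]
    refine eq_zero_of_mem_span_Hpoly (sub_mem hg hp2) ?_
    rw [show a * Hpoly F q + b * f - p = a * Hpoly F q + (b - b') * f + (b' * f - p) by ring]
    exact add_mem (add_mem (Ideal.mul_mem_left _ _ (Ideal.mem_span_singleton_self _))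
      (Ideal.mul_mem_right _ _ hbb)) hp3
  refine ⟨_, natDegree_symbol_mem_semigroup hb0 hb', ?_⟩
  rw [← hpg]
  refine le_antisymm (Polynomial.le_natDegree_of_ne_zero ?_) (natDegree_symbol_le hp1)
  rw [hp4, hc]
  exact mul_ne_zero hbl hfd

/-- The exponent of weighted degree `k` and `x`-degree at most `q`, if `k` lies in the semigroup
generated by `q` and `q + 1`. -/
noncomputable def expo (q k : ℕ) : Fin 2 →₀ ℕ :=
  open Classical in
  if h : k ∈ semigroup q then
    Finsupp.single 0 (exists_le_of_mem_semigroup h).choose +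
      Finsupp.single 1 (exists_le_of_mem_semigroup h).choose_spec.choose
  else 0

lemma expo_zero_le (q k : ℕ) : expo q k 0 ≤ q := by
  rw [expo]
  split_ifs with h
  · simpa using (exists_le_of_mem_semigroup h).choose_spec.choose_spec.1
  · simp

lemma wdeg_expo {k : ℕ} (h : k ∈ semigroup q) : wdeg q (expo q k) = k := by
  rw [expo, dif_pos h]
  simpa [wdeg] using (exists_le_of_mem_semigroup h).choose_spec.choose_spec.2

variable (F) in
/-- The reduced monomial of weighted degree `k`. -/
noncomputable def mono (q k : ℕ) : MvPolynomial (Fin 2) F := monomial (expo q k) 1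

lemma mono_mem_reduced (k : ℕ) : mono F q k ∈ reduced F q :=
  monomial_mem_reduced _ (expo_zero_le q k)

lemma mono_mem_weightLT {k : ℕ} (h : k ∈ semigroup q) : mono F q k ∈ weightLT F q (k + 1) :=
  monomial_mem_weightLT _ (by rw [wdeg_expo h]; omega)

lemma symbol_mono {k : ℕ} (h : k ∈ semigroup q) : symbol F q (mono F q k) = Polynomial.X ^ k := by
  rw [mono, symbol_monomial, wdeg_expo h, Polynomial.monomial_one_right_eq_X_pow]

lemma exists_mem_span_mono (hq : 2 ≤ q) {d : ℕ} {f : MvPolynomial (Fin 2) F}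
    (hf : f ∈ weightLT F q (d + 1)) (hfd : (symbol F q f).coeff d ≠ 0) (k : ℕ) :
    ∀ p ∈ weightLT F q k, ∃ g ∈ Submodule.span F (mono F q '' {j | j ∈ apery q d ∧ j < k}),
      p - g ∈ Ideal.span {Hpoly F q, f} := by
  have hle : Ideal.span {Hpoly F q} ≤ Ideal.span {Hpoly F q, f} :=
    Ideal.span_mono (by simp)
  induction k with
  | zero =>
    intro p hp
    refine ⟨0, zero_mem _, ?_⟩
    have : p = 0 := by
      rw [← support_eq_empty, Finset.eq_empty_iff_forall_notMem]
      exact fun e he => absurd (hp he) (Nat.not_lt_zero _)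
    simp [this]
  | succ k ih =>
    intro p hp
    suffices h : ∃ g ∈ Submodule.span F (mono F q '' {j | j ∈ apery q d ∧ j < k + 1}),
        ∃ r ∈ Ideal.span {Hpoly F q, f}, p - g - r ∈ weightLT F q (k + 1) ∧
          (symbol F q (p - g - r)).coeff k = 0 by
      obtain ⟨g, hg, r, hr, hw, h0⟩ := h
      obtain ⟨p', hp', hH⟩ := exists_lower_weight hq hw h0
      obtain ⟨g', hg', hJ⟩ := ih p' hp'
      refine ⟨g + g', add_mem hg (Submodule.span_mono ?_ hg'), ?_⟩
      · exact Set.image_mono fun j hj => ⟨hj.1, hj.2.trans (Nat.lt_succ_self k)⟩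
      · rw [show p - (g + g') = (p - g - r - p') + (p' - g') + r by ring]
        exact add_mem (add_mem (hle hH) hJ) hr
    by_cases hk : k ∈ semigroup q
    · by_cases hA : k ∈ apery q d
      · refine ⟨(symbol F q p).coeff k • mono F q k, Submodule.smul_mem _ _
          (Submodule.subset_span ⟨k, ⟨hA, Nat.lt_succ_self k⟩, rfl⟩), 0, zero_mem _, ?_, ?_⟩
        · rw [sub_zero]
          exact sub_mem hp (Submodule.smul_mem _ _ (mono_mem_weightLT hk))
        · simp [symbol_mono hk]
      · obtain ⟨l, hl, rfl⟩ : ∃ l ∈ semigroup q, l + d = k := by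
          by_contra! h
          exact hA (mem_apery.2 ⟨hk, h⟩)
        refine ⟨0, zero_mem _, ((symbol F q p).coeff (l + d) / (symbol F q f).coeff d) •
          (mono F q l * f), ?_, ?_, ?_⟩
        · rw [smul_eq_C_mul]
          exact Ideal.mul_mem_left _ _ (Ideal.mul_mem_left _ _ (Ideal.subset_span (by simp)))
        · rw [sub_zero]
          exact sub_mem hp (Submodule.smul_mem _ _ (mul_mem_weightLT (mono_mem_weightLT hl) hf))
        · rw [sub_zero, map_sub, map_smul, Polynomial.coeff_sub, Polynomial.coeff_smul,
            coeff_symbol_mul (mono_mem_weightLT hl) hf, symbol_mono hl, Polynomial.coeff_X_pow_self,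
            one_mul, smul_eq_mul, div_mul_cancel₀ _ hfd, sub_self]
    · refine ⟨0, zero_mem _, 0, zero_mem _, by simpa using hp, ?_⟩
      rw [sub_zero, sub_zero, coeff_symbol]
      exact Finset.sum_eq_zero fun e _ => if_neg fun he => hk ⟨_, _, he⟩

end Reduction

section Points

variable {F : Type} [Field F] {q : ℕ}

lemma prod_X_sub_C_univ [Fintype F] (i : Fin 2) :
    ∏ a : F, ((X i : MvPolynomial (Fin 2) F) - C a) = X i ^ Fintype.card F - X i := by
  have h1 : (Polynomial.X ^ Fintype.card F - Polynomial.X : Polynomial F).Monic :=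
    Polynomial.monic_X_pow_sub (by
      rw [Polynomial.degree_X]
      exact_mod_cast Fintype.one_lt_card)
  have h2 := Polynomial.prod_multiset_X_sub_C_of_monic_of_roots_card_eq h1 (by
    rw [FiniteField.roots_X_pow_card_sub_X,
      FiniteField.X_pow_card_sub_X_natDegree_eq F Fintype.one_lt_card]
    rfl)
  rw [FiniteField.roots_X_pow_card_sub_X] at h2
  have h3 := congrArg (Polynomial.aeval (X i : MvPolynomial (Fin 2) F)) h2
  rw [map_multiset_prod, Multiset.map_map] at h3
  simpa [algebraMap_eq] using h3

lemma mem_of_forall_evalPt_eq_zero [Fintype F] {J : Ideal (MvPolynomial (Fin 2) F)}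
    (hx : X 0 ^ Fintype.card F - X 0 ∈ J) (hy : X 1 ^ Fintype.card F - X 1 ∈ J)
    {p : MvPolynomial (Fin 2) F} (hp : ∀ P : F × F, evalPt P p = 0) : p ∈ J := by
  obtain ⟨h, -, rfl⟩ := combinatorial_nullstellensatz_exists_linearCombination
    (fun _ => (Finset.univ : Finset F)) (fun _ => Finset.univ_nonempty) p fun x _ => by
      have := hp (x 0, x 1)
      rwa [evalPt, show ![(x 0, x 1).1, (x 0, x 1).2] = x by ext i; fin_cases i <;> rfl] at this
  rw [Finsupp.linearCombination_apply, Finsupp.sum]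
  refine sum_mem fun i _ => ?_
  rw [prod_X_sub_C_univ]
  refine Ideal.mul_mem_left _ _ ?_
  fin_cases i
  · exact hx
  · exact hy

lemma evalPt_mul (P : F × F) (p r : MvPolynomial (Fin 2) F) :
    evalPt P (p * r) = evalPt P p * evalPt P r := map_mul _ _ _

lemma mem_span_pair_iff_forall_evalPt_eq_zero [Fintype F] {h f p : MvPolynomial (Fin 2) F}
    (hx : X 0 ^ Fintype.card F - X 0 ∈ Ideal.span {h, f})
    (hy : X 1 ^ Fintype.card F - X 1 ∈ Ideal.span {h, f}) :
    p ∈ Ideal.span {h, f} ↔ ∀ P : F × F, evalPt P h = 0 ∧ evalPt P f = 0 → evalPt P p = 0 := by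
  constructor
  · intro hp P hP
    obtain ⟨a, b, rfl⟩ := Ideal.mem_span_pair.1 hp
    simp only [evalPt, map_add, map_mul] at hP ⊢
    rw [hP.1, hP.2, mul_zero, mul_zero, add_zero]
  · intro hp
    obtain ⟨n, hn⟩ : ∃ n, Fintype.card F - 1 = n + 1 :=
      ⟨Fintype.card F - 2, by have := Fintype.one_lt_card (α := F); omega⟩
    have hone : ∀ a : F, a ≠ 0 → a ^ (n + 1) = 1 := fun a ha => by
      rw [← hn, FiniteField.pow_card_sub_one_eq_one a ha]
    have hz : p * ((1 - h ^ (n + 1)) * (1 - f ^ (n + 1))) ∈ Ideal.span {h, f} := by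
      refine mem_of_forall_evalPt_eq_zero hx hy fun P => ?_
      by_cases hP : evalPt P h = 0 ∧ evalPt P f = 0
      · rw [evalPt_mul, hp P hP, zero_mul]
      · simp only [evalPt, map_mul, map_sub, map_one, map_pow] at hP ⊢
        rcases not_and_or.1 hP with h' | h'
        · rw [hone _ h']
          ring
        · rw [hone _ h']
          ring
    have hmem : ∀ r s : MvPolynomial (Fin 2) F, r * h + s * f ∈ Ideal.span {h, f} :=
      fun r s => Ideal.mem_span_pair.2 ⟨r, s, rfl⟩
    have := add_mem hz (hmem (p * h ^ n) (p * f ^ n * (1 - h ^ (n + 1))))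
    convert this using 1
    ring

/-- Evaluation of polynomials at the points of `D`. -/
noncomputable def evalOn (D : Set (F × F)) : MvPolynomial (Fin 2) F →ₗ[F] (D → F) :=
  LinearMap.pi fun P => (aeval ![P.1.1, P.1.2]).toLinearMap

lemma evalOn_apply (D : Set (F × F)) (p : MvPolynomial (Fin 2) F) (P : D) :
    evalOn D p P = evalPt P.1 p := by
  simp [evalOn, evalPt, aeval_eq_eval]

lemma span_mono_le_reduced (q : ℕ) (S : Set ℕ) :
    Submodule.span F (mono F q '' S) ≤ reduced F q := by
  rw [Submodule.span_le]
  rintro _ ⟨k, -, rfl⟩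
  exact mono_mem_reduced k

lemma mem_of_coeff_symbol_ne_zero {S : Set ℕ} (hS : S ⊆ semigroup q)
    {g : MvPolynomial (Fin 2) F} (hg : g ∈ Submodule.span F (mono F q '' S)) {n : ℕ}
    (hn : (symbol F q g).coeff n ≠ 0) : n ∈ S := by
  by_contra hnS
  refine hn ?_
  clear hn
  induction hg using Submodule.span_induction with
  | mem x hx =>
    obtain ⟨k, hk, rfl⟩ := hx
    rw [symbol_mono (hS hk), Polynomial.coeff_X_pow, if_neg]
    rintro rfl
    exact hnS hk
  | zero => simp
  | add x y _ _ hx hy => simp [hx, hy]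
  | smul a x _ hx => simp [hx]

lemma linearIndependent_evalOn_mono (hq : 2 ≤ q) {d : ℕ} {f : MvPolynomial (Fin 2) F}
    (hf : f ∈ weightLT F q (d + 1)) (hfd : (symbol F q f).coeff d ≠ 0) {D : Set (F × F)}
    (hD : ∀ p, p ∈ Ideal.span {Hpoly F q, f} ↔ evalOn D p = 0) :
    LinearIndependent F fun k : apery q d => evalOn D (mono F q k) := by
  rw [Fintype.linearIndependent_iff]
  intro a ha
  have hS : ∀ k : apery q d, (k : ℕ) ∈ semigroup q := fun k => (mem_apery.1 k.2).1
  set g : MvPolynomial (Fin 2) F := ∑ k : apery q d, a k • mono F q k with hg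
  have hgspan : g ∈ Submodule.span F (mono F q '' (apery q d : Set ℕ)) :=
    sum_mem fun k _ => Submodule.smul_mem _ _ (Submodule.subset_span ⟨k, k.2, rfl⟩)
  have hgJ : g ∈ Ideal.span {Hpoly F q, f} := by
    rw [hD, hg, map_sum, ← ha]
    simp
  have hgr := span_mono_le_reduced q _ hgspan
  have hg0 : g = 0 := by
    by_contra hne
    obtain ⟨l, hl, hl'⟩ := exists_natDegree_symbol_eq hq hf hfd hgr hgJ hne
    have hn : (symbol F q g).natDegree ∈ (apery q d : Set ℕ) :=
      mem_of_coeff_symbol_ne_zero (fun k hk => hS ⟨k, hk⟩) hgspan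
        (Polynomial.leadingCoeff_ne_zero.2 (mt (eq_zero_of_symbol_eq_zero hgr) hne))
    exact (mem_apery.1 hn).2 l hl hl'
  intro i
  have hi : (symbol F q g).coeff i = a i := by
    simp only [hg, map_sum, map_smul, symbol_mono (hS _), Polynomial.finsetSum_coeff,
      Polynomial.coeff_smul, Polynomial.coeff_X_pow, smul_eq_mul, mul_ite, mul_one, mul_zero]
    rw [Finset.sum_eq_single i]
    · simp
    · exact fun j _ hj => if_neg fun h => hj (Subtype.ext h.symm)
    · simp
  rw [← hi, hg0, map_zero, Polynomial.coeff_zero]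

lemma evalOn_surjective [Finite F] (D : Set (F × F)) :
    Function.Surjective (evalOn D) := by
  classical
  have := Fintype.ofFinite F
  intro u
  have h : (fun v : Fin 2 → F => if h : (v 0, v 1) ∈ D then u ⟨_, h⟩ else 0) ∈
      (restrictDegree (Fin 2) F (Fintype.card F - 1)).map (evalₗ F (Fin 2)) := by
    rw [map_restrict_dom_evalₗ]
    trivial
  obtain ⟨p, -, hp⟩ := h
  refine ⟨p, funext fun P => ?_⟩
  rw [evalOn_apply, evalPt, ← evalₗ_apply, hp]
  simp

lemma span_range_evalOn_mono [Finite F] (hq : 2 ≤ q) {d : ℕ} {f : MvPolynomial (Fin 2) F}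
    (hf : f ∈ weightLT F q (d + 1)) (hfd : (symbol F q f).coeff d ≠ 0) {D : Set (F × F)}
    (hD : ∀ p, p ∈ Ideal.span {Hpoly F q, f} ↔ evalOn D p = 0) :
    ⊤ ≤ Submodule.span F (Set.range fun k : apery q d => evalOn D (mono F q k)) := by
  intro u _
  obtain ⟨p, rfl⟩ := evalOn_surjective D u
  obtain ⟨k, hk⟩ := exists_mem_weightLT q p
  obtain ⟨g, hg, hJ⟩ := exists_mem_span_mono hq hf hfd _ p hk
  rw [hD, map_sub, sub_eq_zero] at hJ
  rw [hJ]
  refine Submodule.span_mono ?_ (Submodule.apply_mem_span_image_of_mem_span (evalOn D) hg)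
  rintro _ ⟨_, ⟨j, hj, rfl⟩, rfl⟩
  exact ⟨⟨j, hj.1⟩, rfl⟩

theorem ncard_eq_and_exists_dual_weights [Fintype F] (hq : 2 ≤ q) {d M : ℕ} (hd : d ∈ semigroup q)
    (hdpos : 0 < d) (hM : M + q + 1 = q ^ 2 + d) {f : MvPolynomial (Fin 2) F}
    (hf : f ∈ weightLT F q (d + 1)) (hfd : (symbol F q f).coeff d ≠ 0) {D : Set (F × F)}
    (hD : ∀ p, p ∈ Ideal.span {Hpoly F q, f} ↔ evalOn D p = 0) :
    D.ncard = d ∧ ∃ c : F × F → F, (∀ P, c P ≠ 0 ↔ P ∈ D) ∧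
      ∀ p ∈ weightLT F q M, ∑ P, c P * evalPt P p = 0 := by
  classical
  have := Fintype.ofFinite D
  set b := Module.Basis.mk (linearIndependent_evalOn_mono hq hf hfd hD)
    (span_range_evalOn_mono hq hf hfd hD)
  have hb : ∀ k : apery q d, b k = evalOn D (mono F q k) := fun k => Module.Basis.mk_apply _ _ k
  have hcard : D.ncard = d := by
    have h1 := Module.finrank_eq_card_basis b
    rw [Module.finrank_fintype_fun_eq_card, Fintype.card_coe, card_apery hd] at h1
    rw [← h1, ← Nat.card_coe_set_eq, Nat.card_eq_fintype_card]
  have hMA := top_mem_apery hdpos hM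
  set φ : (D → F) →ₗ[F] F := b.coord ⟨M, hMA⟩
  have hφM : φ (evalOn D (mono F q M)) = 1 := by
    rw [← hb ⟨M, hMA⟩]
    simp [φ]
  have hφ : ∀ p ∈ weightLT F q M, φ (evalOn D p) = 0 := by
    intro p hp
    obtain ⟨g, hg, hJ⟩ := exists_mem_span_mono hq hf hfd M p hp
    rw [hD, map_sub, sub_eq_zero] at hJ
    rw [hJ]
    have : Submodule.span F (mono F q '' {j | j ∈ apery q d ∧ j < M}) ≤
        LinearMap.ker (φ ∘ₗ evalOn D) := by
      rw [Submodule.span_le]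
      rintro _ ⟨j, ⟨hj, hj'⟩, rfl⟩
      have hne : (⟨j, hj⟩ : apery q d) ≠ ⟨M, hMA⟩ := fun h => hj'.ne (congrArg Subtype.val h)
      change φ (evalOn D (mono F q j)) = 0
      rw [← hb ⟨j, hj⟩]
      simp [φ, hne]
    exact this hg
  have hne : ∀ P : D, φ (Pi.single P 1) ≠ 0 := by
    intro P hP
    obtain ⟨p, hp⟩ := evalOn_surjective D (Pi.single P 1)
    obtain ⟨k, hk⟩ := exists_mem_weightLT q p
    obtain ⟨g, hg, hJ⟩ := exists_mem_span_mono hq hf hfd _ p hk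
    rw [hD, map_sub, sub_eq_zero, hp] at hJ
    have hgr := span_mono_le_reduced q _ hg
    have hg0 : g ≠ 0 := by
      rintro rfl
      have := congrFun hJ P
      simp at this
    have hlead := Polynomial.leadingCoeff_ne_zero.2 (mt (eq_zero_of_symbol_eq_zero hgr) hg0)
    have hn := mem_of_coeff_symbol_ne_zero (fun j hj => (mem_apery.1 hj.1).1) hg hlead
    obtain ⟨l, hl, hln⟩ := exists_compl_of_mem_apery hM hn.1
    set α := (symbol F q g).leadingCoeff
    have hgw := mem_weightLT_of_mem_reduced hgr
    have hMs := (mem_apery.1 hMA).1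
    have hw : mono F q l * g - α • mono F q M ∈ weightLT F q (M + 1) := by
      refine sub_mem ?_ (Submodule.smul_mem _ _ (mono_mem_weightLT hMs))
      have := mul_mem_weightLT (mono_mem_weightLT (F := F) hl) hgw
      rwa [hln] at this
    have h0 : (symbol F q (mono F q l * g - α • mono F q M)).coeff M = 0 := by
      have := coeff_symbol_mul (mono_mem_weightLT (F := F) hl) hgw
      rw [hln, symbol_mono hl, Polynomial.coeff_X_pow_self, one_mul] at this
      rw [map_sub, map_smul, Polynomial.coeff_sub, Polynomial.coeff_smul, this, symbol_mono hMs,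
        Polynomial.coeff_X_pow_self, smul_eq_mul, mul_one]
      exact sub_self _
    obtain ⟨p', hp', hpH⟩ := exists_lower_weight hq hw h0
    have hpJ := Ideal.span_mono (t := {Hpoly F q, f}) (by simp) hpH
    rw [hD, map_sub, sub_eq_zero] at hpJ
    have h1 := hφ p' hp'
    have h2 : evalOn D (mono F q l * g) = evalPt P.1 (mono F q l) • Pi.single P (1 : F) := by
      ext Q
      rw [evalOn_apply, evalPt_mul, ← evalOn_apply D g, ← hJ, Pi.smul_apply, smul_eq_mul]
      by_cases hQ : Q = P
      · rw [hQ]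
      · simp [hQ]
    rw [← hpJ, map_sub, map_smul, map_sub, map_smul, hφM, h2, map_smul, hP] at h1
    simp only [smul_eq_mul, mul_zero, mul_one, zero_sub, neg_eq_zero] at h1
    exact hlead h1
  refine ⟨hcard, fun P => if h : P ∈ D then φ (Pi.single ⟨P, h⟩ 1) else 0, fun P => ?_,
    fun p hp => ?_⟩
  · by_cases h : P ∈ D
    · simp only [h, dif_pos, iff_true]
      exact hne ⟨P, h⟩
    · simp [h]
  · have h1 : φ (evalOn D p) = ∑ P : D, φ (Pi.single P 1) * evalPt P.1 p := by
      rw [LinearMap.pi_apply_eq_sum_univ φ]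
      refine Finset.sum_congr rfl fun P _ => ?_
      rw [evalOn_apply, smul_eq_mul, mul_comm]
      congr 2
      ext Q
      simp [Pi.single_apply, eq_comm]
    refine Eq.trans ?_ (h1.symm.trans (hφ p hp))
    refine (Fintype.sum_of_injective Subtype.val Subtype.val_injective _ _ (fun P hP => ?_)
      fun P => ?_).symm
    · rw [Subtype.range_coe] at hP
      simp only [dif_neg hP, zero_mul]
    · simp only [dif_pos P.2]

end Points

end HermitianCode

theorem stmt_17 (q : ℕ) (hq2 : 2 ≤ q) (hq : IsPrimePow q)
    (F : Type) [Field F] [Fintype F] (hF : Fintype.card F = q ^ 2)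
    (P : Fin (q ^ 3) → F × F) (hPinj : Function.Injective P)
    (hPrange : Set.range P = Eset F q)
    (m μ lam d : ℕ) (hm1 : 2 * q ^ 2 - 2 * q - 2 ≤ m) (hm2 : m ≤ q ^ 3 + q * (q - 1) - 2)
    (hB : ∃ p ∈ Bset q, p.1 * q + p.2 * (q + 1) = m + 1)
    (hμ : μ ≤ q) (hmeq : m = μ * q + (lam + q - 2) * (q + 1))
    (hd : d = μ * q + lam * (q + 1))
    (f : MvPolynomial (Fin 2) F) (hlm : IsLMwith precOrd f μ lam)
    (hx : (X 0 : MvPolynomial (Fin 2) F) ^ (q ^ 2) - X 0 ∈ Ideal.span {Hpoly F q, f})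
    (hy : (X 1 : MvPolynomial (Fin 2) F) ^ (q ^ 2) - X 1 ∈ Ideal.span {Hpoly F q, f})
    (D : Set (F × F))
    (hDdef : D = {p : F × F | evalPt p (Hpoly F q) = 0 ∧ evalPt p f = 0}) :
    D ⊆ Eset F q ∧ D.ncard = d ∧
      ∃ c ∈ codeSet F q m P, c ≠ 0 ∧ wt c = d ∧ suppPts P c = D := by
  have hM : m + 1 + q + 1 = q ^ 2 + d := by
    obtain ⟨t, rfl⟩ := Nat.exists_eq_add_of_le hq2
    rw [hmeq, hd, show lam + (2 + t) - 2 = lam + t by omega]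
    ring
  have hdpos : 0 < d := by
    by_contra! h
    have : 2 * q ≤ q ^ 2 := by nlinarith
    omega
  have hsupp : ∀ e ∈ f.support, e ≠ Finsupp.single 0 μ + Finsupp.single 1 lam →
      HermitianCode.wdeg q e < d := by
    intro e he hne
    rcases hlm.2 e he with h | h
    · refine absurd ?_ hne
      simp only [expPair, Prod.mk.injEq] at h
      ext i
      fin_cases i
      · simpa using h.1
      · simpa using h.2
    · simp only [precOrd, expPair] at h
      rw [hd, HermitianCode.wdeg]
      rcases h with h | ⟨h, h'⟩ <;> nlinarith
  have htop : HermitianCode.wdeg q (Finsupp.single 0 μ + Finsupp.single 1 lam) = d := by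
    simp [HermitianCode.wdeg, hd]
  have hf : f ∈ HermitianCode.weightLT F q (d + 1) := by
    intro e he
    by_cases hne : e = Finsupp.single 0 μ + Finsupp.single 1 lam
    · rw [Set.mem_ofPred_eq, hne, htop]
      omega
    · exact (hsupp e he hne).trans (Nat.lt_succ_self d)
  have hfd : (HermitianCode.symbol F q f).coeff d ≠ 0 := by
    rw [HermitianCode.coeff_symbol,
      Finset.sum_eq_single (Finsupp.single 0 μ + Finsupp.single 1 lam), if_pos htop]
    · exact hlm.1
    · exact fun e he hne => if_neg (hsupp e he hne).ne
    · exact fun h => absurd (mem_support_iff.2 hlm.1) h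
  have hD : ∀ p, p ∈ Ideal.span {Hpoly F q, f} ↔ HermitianCode.evalOn D p = 0 := by
    intro p
    rw [← hF] at hx hy
    rw [HermitianCode.mem_span_pair_iff_forall_evalPt_eq_zero hx hy, funext_iff]
    simp only [HermitianCode.evalOn_apply, Pi.zero_apply, Subtype.forall, hDdef,
      Set.mem_ofPred_eq]
  have hDE : D ⊆ Eset F q := by
    intro P hP
    rw [hDdef] at hP
    have h := hP.1
    simp only [evalPt, Hpoly, map_sub, map_pow, eval_X, Matrix.cons_val_zero,
      Matrix.cons_val_one] at h
    change P.1 ^ (q + 1) = P.2 ^ q + P.2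
    linear_combination h
  obtain ⟨hcard, c, hc, hsum⟩ :=
    HermitianCode.ncard_eq_and_exists_dual_weights hq2 ⟨μ, lam, hd.symm⟩ hdpos hM hf hfd hD
  have hsuppD : suppPts P (fun i => c (P i)) = D := by
    ext Q
    constructor
    · rintro ⟨i, hi, rfl⟩
      exact (hc _).1 hi
    · intro hQ
      obtain ⟨i, rfl⟩ : Q ∈ Set.range P := hPrange ▸ hDE hQ
      exact ⟨i, (hc _).2 hQ, rfl⟩
  have hwt : wt (fun i => c (P i)) = d := by
    rw [← hcard, ← hsuppD, suppPts, Set.ncard_image_of_injective _ hPinj, wt]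
  refine ⟨hDE, hcard, fun i => c (P i), ?_, ?_, hwt, hsuppD⟩
  · intro r s hrs
    have hmem : monoXY F r s ∈ HermitianCode.weightLT F q (m + 1) := by
      rw [monoXY, X_pow_eq_monomial, X_pow_eq_monomial, monomial_mul, one_mul]
      refine HermitianCode.monomial_mem_weightLT _ ?_
      simpa [HermitianCode.wdeg, Nat.lt_succ_iff] using hrs
    rw [← hsum _ hmem]
    refine Fintype.sum_of_injective P hPinj _ _ (fun Q hQ => ?_) fun i => ?_
    · rw [not_not.1 (mt (hc Q).1 fun hQD => hQ (hPrange ▸ hDE hQD)), zero_mul]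
    · simp [evalPt, monoXY]
  · intro h
    rw [h] at hwt
    simp [wt] at hwt
    omega
end
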